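/- Let Ω⁺ ⊂ ℝ³ be a non-empty bounded open set. Then the unconstrained minimization problem min{ E(Ω⁻) : Ω⁻ ⊂ ℝ³ measurable, |Ω⁺ ∩ Ω⁻| = 0, |Ω⁻| < ∞ } admits a solution Ω⁻, this solution is unique up to a set of Lebesgue measure zero, and the minimizer satisfies the charge neutrality (saturation) property |Ω⁻| = |Ω⁺|. -/

import Mathlib

open MeasureTheory Real

noncomputable section

abbrev E3 := EuclideanSpace ℝ (Fin 3)

/-- The Coulomb kernel in ℝ³. -/
def coul (x y : E3) : ℝ := 1 / (4 * π * ‖x - y‖)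

/-- The Coulomb energy `E(Ω⁻)` of a negative phase `Ωm` in the field of the
positive phase `Ωp`. -/
def energy (Ωp Ωm : Set E3) : ℝ :=
  (∫ x in Ωp, ∫ y in Ωp, coul x y) + (∫ x in Ωm, ∫ y in Ωm, coul x y)
    - 2 * ∫ x in Ωp, ∫ y in Ωm, coul x y

/-- Admissible configurations for the unconstrained problem. -/
def Adm (Ωp Ωm : Set E3) : Prop :=
  MeasurableSet Ωm ∧ volume (Ωp ∩ Ωm) = 0 ∧ volume Ωm < ⊤

section Heat

open Set Filter Topology

/-- The heat kernel in ℝ³. -/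
def heat (t : ℝ) (z : E3) : ℝ := (4 * π * t) ^ (-(3 / 2) : ℝ) * rexp (-(‖z‖ ^ 2 / (4 * t)))

lemma heat_pos {t : ℝ} (ht : 0 < t) (z : E3) : 0 < heat t z := by
  unfold heat; positivity

lemma heat_le {t : ℝ} (ht : 0 < t) (z : E3) : heat t z ≤ (4 * π * t) ^ (-(3 / 2) : ℝ) := by
  unfold heat
  refine mul_le_of_le_one_right (by positivity) (Real.exp_le_one_iff.2 ?_)
  have : 0 ≤ ‖z‖ ^ 2 / (4 * t) := by positivity
  linarith

lemma heat_neg (t : ℝ) (z : E3) : heat t (-z) = heat t z := by simp [heat]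

lemma heat_sub_comm (t : ℝ) (x y : E3) : heat t (x - y) = heat t (y - x) := by
  rw [← heat_neg, neg_sub]

lemma continuous_heat (t : ℝ) : Continuous (heat t) := by
  unfold heat; fun_prop

lemma measurable_heat : Measurable (fun p : ℝ × E3 => heat p.1 p.2) := by
  unfold heat; fun_prop

lemma integrable_exp_neg_norm_sq {b : ℝ} (hb : 0 < b) :
    Integrable (fun v : E3 => rexp (-b * ‖v‖ ^ 2)) := by
  by_contra h
  have := GaussianFourier.integral_rexp_neg_mul_sq_norm (V := E3) hb
  rw [integral_undef h] at this
  have h2 : 0 < (π / b) ^ (Module.finrank ℝ E3 / 2 : ℝ) := by positivity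
  linarith

lemma heat_eq (t : ℝ) (z : E3) :
    heat t z = (4 * π * t) ^ (-(3 / 2) : ℝ) * rexp (-(1 / (4 * t)) * ‖z‖ ^ 2) := by
  unfold heat; congr 2; ring

lemma integrable_heat {t : ℝ} (ht : 0 < t) : Integrable (heat t) := by
  simp_rw [funext (heat_eq t)]
  exact (integrable_exp_neg_norm_sq (by positivity)).const_mul _

lemma integral_heat {t : ℝ} (ht : 0 < t) : ∫ z, heat t z = 1 := by
  simp_rw [funext (heat_eq t)]
  rw [integral_const_mul, GaussianFourier.integral_rexp_neg_mul_sq_norm (by positivity)]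
  have : π / (1 / (4 * t)) = 4 * π * t := by field_simp
  rw [this]
  simp only [finrank_euclideanSpace, Fintype.card_fin, Nat.cast_ofNat]
  rw [← rpow_add (by positivity)]
  norm_num

lemma integrable_heat_sub {t : ℝ} (ht : 0 < t) (x : E3) :
    Integrable (fun y => heat t (x - y)) :=
  (integrable_heat ht).comp_sub_left x

lemma integral_heat_sub {t : ℝ} (ht : 0 < t) (x : E3) : ∫ y, heat t (x - y) = 1 := by
  rw [integral_sub_left_eq_self (heat t) volume x, integral_heat ht]

lemma heat_mul_heat {s t : ℝ} (hs : 0 < s) (ht : 0 < t) (x y : E3) :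
    heat s (x - y) * heat t y =
      heat (s + t) x * heat (s * t / (s + t)) (y - (t / (s + t)) • x) := by
  unfold heat
  have hst : 0 < s + t := by positivity
  rw [mul_mul_mul_comm _ (rexp _), mul_mul_mul_comm _ (rexp _), ← Real.exp_add, ← Real.exp_add,
    ← mul_rpow (by positivity) (by positivity), ← mul_rpow (by positivity) (by positivity)]
  congr 2
  · field_simp
  · have h1 : ‖x - y‖ ^ 2 = ‖x‖ ^ 2 - 2 * inner ℝ x y + ‖y‖ ^ 2 := norm_sub_sq_real x y
    have h2 : ‖y - (t / (s + t)) • x‖ ^ 2 =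
        ‖y‖ ^ 2 - 2 * ((t / (s + t)) * inner ℝ x y) + (t / (s + t)) ^ 2 * ‖x‖ ^ 2 := by
      rw [norm_sub_sq_real, inner_smul_right, norm_smul, mul_pow, real_inner_comm, norm_eq_abs, sq_abs]
    rw [h1, h2]
    field_simp
    ring

lemma integral_heat_mul_heat {s t : ℝ} (hs : 0 < s) (ht : 0 < t) (x : E3) :
    ∫ y, heat s (x - y) * heat t y = heat (s + t) x := by
  simp_rw [heat_mul_heat hs ht, integral_const_mul]
  rw [integral_sub_right_eq_self (heat (s * t / (s + t))), integral_heat (by positivity), mul_one]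

lemma integral_heat_time {z : E3} (hz : z ≠ 0) :
    ∫ s in Ioi 0, heat s z = 1 / (4 * π * ‖z‖) := by
  rw [← integral_comp_rpow_Ioi (fun s => heat s z) (p := -1) (by norm_num)]
  have hr : 0 < ‖z‖ := norm_pos_iff.2 hz
  have : ∀ s ∈ Ioi (0 : ℝ), (|(-1 : ℝ)| * s ^ ((-1 : ℝ) - 1)) • heat (s ^ (-1 : ℝ)) z =
      (4 * π) ^ (-(3 / 2) : ℝ) * (s ^ ((1 / 2 : ℝ) - 1) * rexp (-(‖z‖ ^ 2 / 4 * s))) := by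
    intro s hs
    have hs : 0 < s := hs
    unfold heat
    rw [abs_neg, abs_one, one_mul, smul_eq_mul, mul_rpow (by positivity) (by positivity),
      ← rpow_mul hs.le]
    have e1 : s ^ ((1 / 2 : ℝ) - 1) = s ^ ((-1 : ℝ) - 1) * s ^ ((-1 : ℝ) * -(3 / 2)) := by
      rw [← rpow_add hs]; norm_num
    have e2 : ‖z‖ ^ 2 / (4 * s ^ (-1 : ℝ)) = ‖z‖ ^ 2 / 4 * s := by
      rw [rpow_neg_one]; field_simp
    rw [e1, e2]; ring
  rw [setIntegral_congr_fun measurableSet_Ioi this, integral_const_mul,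
    integral_rpow_mul_exp_neg_mul_Ioi (by norm_num) (by positivity), Real.Gamma_one_half_eq,
    ← sqrt_eq_rpow]
  have e3 : √(1 / (‖z‖ ^ 2 / 4)) = 2 / ‖z‖ := by
    rw [sqrt_eq_iff_mul_self_eq (by positivity) (by positivity)]
    field_simp; norm_num
  have e4 : (4 * π) ^ (-(3 / 2) : ℝ) = 1 / (8 * π * √π) := by
    rw [rpow_neg (by positivity), one_div]
    congr 1
    rw [show (3 / 2 : ℝ) = 1 + 1 / 2 by norm_num, rpow_add (by positivity), rpow_one,
      ← sqrt_eq_rpow, sqrt_mul (by norm_num), show √(4 : ℝ) = 2 by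
        rw [show (4 : ℝ) = 2 ^ 2 by norm_num]; exact sqrt_sq (by norm_num)]
    ring
  rw [e3, e4]
  have : 0 < √π := by positivity
  field_simp
  norm_num

lemma coul_eq {x y : E3} (h : x ≠ y) : coul x y = ∫ s in Ioi 0, heat s (x - y) := by
  rw [integral_heat_time (sub_ne_zero.2 h), coul]

lemma coul_nonneg (x y : E3) : 0 ≤ coul x y := by unfold coul; positivity

lemma integrableOn_timeBound (M C : ℝ) (hM : 0 ≤ M) (hC : 0 ≤ C) :
    IntegrableOn (fun s : ℝ => min M ((4 * π * s) ^ (-(3 / 2) : ℝ) * C)) (Ioi 0) := by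
  have hmeas : Measurable (fun s : ℝ => min M ((4 * π * s) ^ (-(3 / 2) : ℝ) * C)) := by fun_prop
  rw [← Ioc_union_Ioi_eq_Ioi zero_le_one]
  refine IntegrableOn.union ?_ ?_
  · refine Integrable.mono' (g := fun _ => M) (integrableOn_const (by simp))
      hmeas.aestronglyMeasurable ?_
    filter_upwards [ae_restrict_mem measurableSet_Ioc] with s hs
    have hs : 0 < s := hs.1
    rw [Real.norm_of_nonneg (le_min hM (by positivity))]
    exact min_le_left _ _
  · refine Integrable.mono' (g := fun s => ((4 * π) ^ (-(3 / 2) : ℝ) * C) * s ^ (-(3 / 2) : ℝ))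
      ((integrableOn_Ioi_rpow_of_lt (by norm_num) one_pos).const_mul _)
      hmeas.aestronglyMeasurable ?_
    filter_upwards [ae_restrict_mem measurableSet_Ioi] with s hs
    have hs : 0 < s := one_pos.trans hs
    rw [Real.norm_of_nonneg (le_min hM (by positivity))]
    refine (min_le_right _ _).trans (le_of_eq ?_)
    rw [mul_rpow (by positivity) hs.le]; ring

end Heat

section Flow

open Set Filter Topology

/-- The heat semigroup acting on functions. -/
def heatFlow (t : ℝ) (f : E3 → ℝ) (x : E3) : ℝ := ∫ y, heat t (x - y) * f y

/-- The Coulomb potential of a charge density. -/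
def pot (f : E3 → ℝ) (x : E3) : ℝ := ∫ y, coul x y * f y

/-- Measurable functions that are almost everywhere bounded by `M`. -/
structure IsBdd (M : ℝ) (f : E3 → ℝ) : Prop where
  meas : Measurable f
  bdd : ∀ᵐ x, |f x| ≤ M

/-- Integrable charge densities that are almost everywhere bounded by `M`. -/
structure IsDensity (M : ℝ) (f : E3 → ℝ) : Prop extends IsBdd M f where
  int : Integrable f

variable {M N s t : ℝ} {f g h : E3 → ℝ}

lemma IsBdd.nonneg (hf : IsBdd M f) : 0 ≤ M := by
  obtain ⟨x, hx⟩ := hf.bdd.exists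
  exact (abs_nonneg _).trans hx

lemma IsBdd.integrable_heat_mul (hf : IsBdd M f) (ht : 0 < t) (x : E3) :
    Integrable (fun y => heat t (x - y) * f y) := by
  refine Integrable.mono' ((integrable_heat_sub ht x).mul_const M) ?_ ?_
  · exact ((continuous_heat t).measurable.comp (measurable_const.sub measurable_id)
      |>.mul hf.meas).aestronglyMeasurable
  · filter_upwards [hf.bdd] with y hy
    rw [norm_mul, Real.norm_of_nonneg (heat_pos ht _).le]
    exact mul_le_mul_of_nonneg_left hy (heat_pos ht _).le

lemma IsBdd.abs_heatFlow_le (hf : IsBdd M f) (ht : 0 < t) (x : E3) : |heatFlow t f x| ≤ M := by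
  rw [← norm_eq_abs, heatFlow]
  refine (norm_integral_le_of_norm_le ((integrable_heat_sub ht x).mul_const M) ?_).trans
    (le_of_eq ?_)
  · filter_upwards [hf.bdd] with y hy
    rw [norm_mul, Real.norm_of_nonneg (heat_pos ht _).le]
    exact mul_le_mul_of_nonneg_left hy (heat_pos ht _).le
  · rw [integral_mul_const, integral_heat_sub ht, one_mul]

lemma abs_heatFlow_le_integral (hf : Integrable f) (ht : 0 < t) (x : E3) :
    |heatFlow t f x| ≤ (4 * π * t) ^ (-(3 / 2) : ℝ) * ∫ y, |f y| := by
  rw [← integral_const_mul, ← norm_eq_abs, heatFlow]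
  refine norm_integral_le_of_norm_le (hf.abs.const_mul _) (ae_of_all _ fun y => ?_)
  rw [norm_mul, Real.norm_of_nonneg (heat_pos ht _).le]
  exact mul_le_mul_of_nonneg_right (heat_le ht _) (abs_nonneg _)

lemma measurable_heatFlow_uncurry (hf : Measurable f) :
    Measurable (fun p : ℝ × E3 => heatFlow p.1 f p.2) := by
  have : StronglyMeasurable (fun q : (ℝ × E3) × E3 => heat q.1.1 (q.1.2 - q.2) * f q.2) := by
    refine (Measurable.mul ?_ (hf.comp measurable_snd)).stronglyMeasurable
    exact measurable_heat.comp ((measurable_fst.comp measurable_fst).prodMk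
      ((measurable_snd.comp measurable_fst).sub measurable_snd))
  exact this.integral_prod_right'.measurable

lemma measurable_heatFlow (hf : Measurable f) (t : ℝ) : Measurable (heatFlow t f) :=
  (measurable_heatFlow_uncurry hf).comp measurable_prodMk_left

lemma IsBdd.isBdd_heatFlow (hf : IsBdd M f) (ht : 0 < t) : IsBdd M (heatFlow t f) :=
  ⟨measurable_heatFlow hf.meas t, ae_of_all _ fun x => hf.abs_heatFlow_le ht x⟩

lemma heatFlow_heatFlow (hf : IsBdd M f) (hs : 0 < s) (ht : 0 < t) (x : E3) :
    heatFlow s (heatFlow t f) x = heatFlow (s + t) f x := by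
  have hfi : Integrable (Function.uncurry fun y z => heat s (x - y) * (heat t (y - z) * f z))
      ((volume : Measure E3).prod volume) := by
    have hm : Measurable (Function.uncurry fun y z : E3 =>
        heat s (x - y) * (heat t (y - z) * f z)) := by
      have h1 := (continuous_heat s).measurable
      have h2 := (continuous_heat t).measurable
      have h3 := hf.meas
      unfold Function.uncurry
      fun_prop
    rw [integrable_prod_iff hm.aestronglyMeasurable]
    refine ⟨ae_of_all _ fun y => (hf.integrable_heat_mul ht y).const_mul (heat s (x - y)), ?_⟩
    refine Integrable.mono' ((integrable_heat_sub hs x).mul_const M)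
      hm.norm.stronglyMeasurable.integral_prod_right'.aestronglyMeasurable
      (ae_of_all _ fun y => ?_)
    simp only [Function.uncurry, norm_mul, integral_const_mul,
      Real.norm_of_nonneg (heat_pos hs _).le, Real.norm_of_nonneg (heat_pos ht _).le]
    have h0 : 0 ≤ ∫ z, heat t (y - z) * ‖f z‖ :=
      integral_nonneg fun z => mul_nonneg (heat_pos ht _).le (norm_nonneg _)
    rw [Real.norm_of_nonneg h0]
    refine mul_le_mul_of_nonneg_left ?_ (heat_pos hs _).le
    have h1 : IsBdd M (fun z => ‖f z‖) := ⟨hf.meas.norm, by simpa using hf.bdd⟩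
    exact (le_abs_self _).trans (h1.abs_heatFlow_le ht y)
  calc heatFlow s (heatFlow t f) x
      = ∫ y, ∫ z, heat s (x - y) * (heat t (y - z) * f z) := by
        simp only [heatFlow, integral_const_mul]
    _ = ∫ z, ∫ y, heat s (x - y) * (heat t (y - z) * f z) := integral_integral_swap hfi
    _ = heatFlow (s + t) f x := by
        refine integral_congr_ae (ae_of_all _ fun z => ?_)
        simp only [← mul_assoc, integral_mul_const]
        congr 1
        rw [← integral_heat_mul_heat hs ht, ← integral_add_right_eq_self _ z]
        refine integral_congr_ae (ae_of_all _ fun y => ?_)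
        simp only [add_sub_cancel_right, sub_sub, add_comm z y]

lemma integrable_mul_heat_mul (hf : Integrable f) (hfm : Measurable f) (hh : IsBdd M h)
    (ht : 0 < t) :
    Integrable (Function.uncurry fun x y => f x * (heat t (x - y) * h y))
      ((volume : Measure E3).prod volume) := by
  have hm : Measurable (Function.uncurry fun x y : E3 => f x * (heat t (x - y) * h y)) := by
    have h2 := (continuous_heat t).measurable
    have h3 := hh.meas
    unfold Function.uncurry
    fun_prop
  rw [integrable_prod_iff hm.aestronglyMeasurable]
  refine ⟨ae_of_all _ fun y => (hh.integrable_heat_mul ht y).const_mul (f y), ?_⟩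
  refine Integrable.mono' (hf.norm.mul_const M)
    hm.norm.stronglyMeasurable.integral_prod_right'.aestronglyMeasurable
    (ae_of_all _ fun y => ?_)
  simp only [Function.uncurry, norm_mul, integral_const_mul,
    Real.norm_of_nonneg (heat_pos ht _).le, norm_norm]
  have h0 : 0 ≤ ∫ z, heat t (y - z) * ‖h z‖ :=
    integral_nonneg fun z => mul_nonneg (heat_pos ht _).le (norm_nonneg _)
  rw [Real.norm_of_nonneg h0]
  refine mul_le_mul_of_nonneg_left ?_ (norm_nonneg _)
  have h1 : IsBdd M (fun z => ‖h z‖) := ⟨hh.meas.norm, by simpa using hh.bdd⟩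
  exact (le_abs_self _).trans (h1.abs_heatFlow_le ht y)

lemma integral_mul_heatFlow (hf : Integrable f) (hfm : Measurable f) (hh : IsBdd M h)
    (ht : 0 < t) : ∫ x, f x * heatFlow t h x = ∫ x, heatFlow t f x * h x := by
  calc ∫ x, f x * heatFlow t h x = ∫ x, ∫ y, f x * (heat t (x - y) * h y) := by
        simp only [heatFlow, integral_const_mul]
    _ = ∫ y, ∫ x, f x * (heat t (x - y) * h y) :=
        integral_integral_swap (integrable_mul_heat_mul hf hfm hh ht)
    _ = ∫ y, heatFlow t f y * h y := by
        refine integral_congr_ae (ae_of_all _ fun y => ?_)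
        simp only [heatFlow]
        rw [← integral_mul_const]
        refine integral_congr_ae (ae_of_all _ fun x => ?_)
        simp only [heat_sub_comm t y x]
        ring

lemma IsDensity.integrable_heatFlow (hf : IsDensity M f) (ht : 0 < t) : Integrable (heatFlow t f) := by
  have h1 : IsBdd 1 (fun _ : E3 => (1 : ℝ)) := ⟨measurable_const, by simp⟩
  have := (integrable_mul_heat_mul hf.int hf.meas h1 ht).integral_prod_right
  refine this.congr (ae_of_all _ fun y => ?_)
  simp only [Function.uncurry, heatFlow, mul_one, heat_sub_comm t y]
  exact integral_congr_ae (ae_of_all _ fun x => mul_comm _ _)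

/-- A time-integrable bound for the heat flow of a density. -/
def timeBound (M C s : ℝ) : ℝ := min M ((4 * π * s) ^ (-(3 / 2) : ℝ) * C)

lemma IsDensity.abs_heatFlow_le_timeBound (hf : IsDensity M f) (ht : 0 < t) (x : E3) :
    |heatFlow t f x| ≤ timeBound M (∫ y, |f y|) t :=
  le_min (hf.toIsBdd.abs_heatFlow_le ht x) (abs_heatFlow_le_integral hf.int ht x)

lemma IsDensity.abs (hf : IsDensity M f) : IsDensity M (fun x => |f x|) :=
  ⟨⟨hf.meas.norm, by simpa using hf.bdd⟩, hf.int.abs⟩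

lemma IsDensity.integrableOn_timeBound (hf : IsDensity M f) :
    IntegrableOn (timeBound M (∫ y, |f y|)) (Ioi 0) :=
  _root_.integrableOn_timeBound M _ hf.nonneg (integral_nonneg fun _ => abs_nonneg _)

lemma IsDensity.integrableOn_heatFlow (hf : IsDensity M f) (x : E3) :
    IntegrableOn (fun s => heatFlow s f x) (Ioi 0) := by
  refine Integrable.mono' hf.integrableOn_timeBound
    ((measurable_heatFlow_uncurry hf.meas).comp measurable_prodMk_right).aestronglyMeasurable ?_
  filter_upwards [ae_restrict_mem measurableSet_Ioi] with s hs
  exact hf.abs_heatFlow_le_timeBound hs x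

lemma IsDensity.integrable_heat_time (hf : IsDensity M f) (x : E3) :
    Integrable (Function.uncurry fun (s : ℝ) (y : E3) => heat s (x - y) * f y)
      ((volume.restrict (Ioi 0)).prod volume) := by
  have hm : Measurable (Function.uncurry fun (s : ℝ) (y : E3) => heat s (x - y) * f y) := by
    refine Measurable.mul ?_ (hf.meas.comp measurable_snd)
    exact measurable_heat.comp (measurable_fst.prodMk (measurable_const.sub measurable_snd))
  rw [integrable_prod_iff hm.aestronglyMeasurable]
  constructor
  · filter_upwards [ae_restrict_mem measurableSet_Ioi] with s hs
    exact hf.integrable_heat_mul hs x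
  · refine (hf.abs.integrableOn_heatFlow x).congr ?_
    filter_upwards [ae_restrict_mem measurableSet_Ioi] with s hs
    refine integral_congr_ae (ae_of_all _ fun y => ?_)
    simp only [Function.uncurry, norm_mul, Real.norm_of_nonneg (heat_pos hs _).le, norm_eq_abs]

lemma coul_mul_ae_eq (f : E3 → ℝ) (x : E3) :
    (fun y => coul x y * f y) =ᵐ[volume] fun y => ∫ s in Ioi 0, heat s (x - y) * f y := by
  have : ∀ᵐ y : E3, y ≠ x := by simp [ae_iff]
  filter_upwards [this] with y hy
  rw [coul_eq hy.symm, integral_mul_const]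

lemma IsDensity.integrable_coul_mul (hf : IsDensity M f) (x : E3) :
    Integrable (fun y => coul x y * f y) :=
  (hf.integrable_heat_time x).integral_prod_right.congr (coul_mul_ae_eq f x).symm

lemma IsDensity.pot_eq (hf : IsDensity M f) (x : E3) :
    pot f x = ∫ s in Ioi 0, heatFlow s f x := by
  unfold pot
  rw [integral_congr_ae (coul_mul_ae_eq f x)]
  exact (integral_integral_swap (hf.integrable_heat_time x)).symm

lemma pot_congr (h : f =ᵐ[volume] g) : pot f = pot g := by
  ext x
  exact integral_congr_ae (h.mono fun y hy => by simp only [hy])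

/-- An upper bound for the potential of a density. -/
def potBound (M : ℝ) (f : E3 → ℝ) : ℝ := ∫ s in Ioi 0, timeBound M (∫ y, |f y|) s

lemma IsDensity.abs_pot_le (hf : IsDensity M f) (x : E3) : |pot f x| ≤ potBound M f := by
  rw [hf.pot_eq, ← norm_eq_abs]
  refine norm_integral_le_of_norm_le hf.integrableOn_timeBound ?_
  filter_upwards [ae_restrict_mem measurableSet_Ioi] with s hs
  exact hf.abs_heatFlow_le_timeBound hs x

lemma continuous_heatFlow (hf : Integrable f) (ht : 0 < t) : Continuous (heatFlow t f) := by
  refine continuous_of_dominated (bound := fun y => (4 * π * t) ^ (-(3 / 2) : ℝ) * |f y|)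
    (fun x => ?_) (fun x => ae_of_all _ fun y => ?_) (hf.abs.const_mul _)
    (ae_of_all _ fun y => ?_)
  · exact ((continuous_heat t).comp (by fun_prop)).aestronglyMeasurable.mul hf.1
  · rw [norm_mul, Real.norm_of_nonneg (heat_pos ht _).le]
    exact mul_le_mul_of_nonneg_right (heat_le ht _) (abs_nonneg _)
  · exact ((continuous_heat t).comp (by fun_prop)).mul continuous_const

lemma IsDensity.continuous_pot (hf : IsDensity M f) : Continuous (pot f) := by
  rw [funext hf.pot_eq]
  refine continuous_of_dominated (bound := timeBound M (∫ y, |f y|))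
    (fun x => (hf.integrableOn_heatFlow x).1) (fun x => ?_) hf.integrableOn_timeBound ?_
  · filter_upwards [ae_restrict_mem measurableSet_Ioi] with s hs
    exact hf.abs_heatFlow_le_timeBound hs x
  · filter_upwards [ae_restrict_mem measurableSet_Ioi] with s hs
    exact continuous_heatFlow hf.int hs

instance : (cocompact E3).IsCountablyGenerated := by
  rw [← Metric.cobounded_eq_cocompact, ← comap_norm_atTop]
  infer_instance

lemma tendsto_heat_cocompact (ht : 0 < t) : Tendsto (heat t) (cocompact E3) (𝓝 0) := by
  have h1 : Tendsto (fun z : E3 => ‖z‖ ^ 2 / (4 * t)) (cocompact E3) atTop :=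
    ((tendsto_pow_atTop two_ne_zero).comp (tendsto_norm_cocompact_atTop (E := E3))).atTop_div_const
      (by positivity)
  have := (tendsto_exp_neg_atTop_nhds_zero.comp h1).const_mul ((4 * π * t) ^ (-(3 / 2) : ℝ))
  rw [mul_zero] at this
  exact this

lemma tendsto_heatFlow_cocompact (hf : Integrable f) (ht : 0 < t) :
    Tendsto (heatFlow t f) (cocompact E3) (𝓝 0) := by
  have : (0 : ℝ) = ∫ y : E3, (0 : ℝ) := by simp
  rw [this]
  refine tendsto_integral_filter_of_dominated_convergence
    (bound := fun y => (4 * π * t) ^ (-(3 / 2) : ℝ) * |f y|)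
    (Eventually.of_forall fun x => ?_) (Eventually.of_forall fun x => ae_of_all _ fun y => ?_)
    (hf.abs.const_mul _) (ae_of_all _ fun y => ?_)
  · exact ((continuous_heat t).comp (by fun_prop)).aestronglyMeasurable.mul hf.1
  · rw [norm_mul, Real.norm_of_nonneg (heat_pos ht _).le]
    exact mul_le_mul_of_nonneg_right (heat_le ht _) (abs_nonneg _)
  · have h1 : Tendsto (fun x : E3 => x - y) (cocompact E3) (cocompact E3) :=
      (Homeomorph.subRight y).isClosedEmbedding.tendsto_cocompact
    simpa using ((tendsto_heat_cocompact ht).comp h1).mul_const (f y)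

lemma IsDensity.tendsto_pot (hf : IsDensity M f) : Tendsto (pot f) (cocompact E3) (𝓝 0) := by
  have key : Tendsto (fun x => ∫ s in Ioi 0, heatFlow s f x) (cocompact E3)
      (𝓝 (∫ s in Ioi (0 : ℝ), (0 : ℝ))) := by
    refine tendsto_integral_filter_of_dominated_convergence (timeBound M (∫ y, |f y|))
      (Eventually.of_forall fun x => (hf.integrableOn_heatFlow x).1)
      (Eventually.of_forall fun x => ?_) hf.integrableOn_timeBound ?_
    · filter_upwards [ae_restrict_mem measurableSet_Ioi] with s hs
      exact hf.abs_heatFlow_le_timeBound hs x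
    · filter_upwards [ae_restrict_mem measurableSet_Ioi] with s hs
      exact tendsto_heatFlow_cocompact hf.int hs
  rw [funext hf.pot_eq]
  simpa using key

lemma IsDensity.isBdd_pot (hf : IsDensity M f) : IsBdd (potBound M f) (pot f) :=
  ⟨hf.continuous_pot.measurable, ae_of_all _ hf.abs_pot_le⟩

lemma IsDensity.heatFlow_pot (hf : IsDensity M f) (ht : 0 < t) (x : E3) :
    heatFlow t (pot f) x = ∫ s in Ioi t, heatFlow s f x := by
  have hfi : Integrable (Function.uncurry fun (y : E3) (s : ℝ) =>
      heat t (x - y) * heatFlow s f y) (volume.prod (volume.restrict (Ioi 0))) := by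
    refine Integrable.mono' ((integrable_heat_sub ht x).mul_prod hf.integrableOn_timeBound) ?_ ?_
    · refine (Measurable.mul ?_ ?_).aestronglyMeasurable
      · exact (continuous_heat t).measurable.comp (measurable_const.sub measurable_fst)
      · exact (measurable_heatFlow_uncurry hf.meas).comp measurable_swap
    · have : ∀ᵐ p : E3 × ℝ ∂(volume.prod (volume.restrict (Ioi 0))), p.2 ∈ Ioi (0 : ℝ) :=
        Measure.quasiMeasurePreserving_snd.ae (ae_restrict_mem measurableSet_Ioi)
      filter_upwards [this] with p hp
      rw [Function.uncurry, norm_mul, Real.norm_of_nonneg (heat_pos ht _).le]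
      exact mul_le_mul_of_nonneg_left (hf.abs_heatFlow_le_timeBound hp _) (heat_pos ht _).le
  calc heatFlow t (pot f) x
      = ∫ y, ∫ s in Ioi 0, heat t (x - y) * heatFlow s f y := by
        simp only [heatFlow, integral_const_mul]
        refine integral_congr_ae (ae_of_all _ fun y => ?_)
        simp only [hf.pot_eq, heatFlow]
    _ = ∫ s in Ioi 0, ∫ y, heat t (x - y) * heatFlow s f y := integral_integral_swap hfi
    _ = ∫ s in Ioi 0, heatFlow (s + t) f x := by
        refine setIntegral_congr_fun measurableSet_Ioi fun s hs => ?_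
        have := heatFlow_heatFlow hf.toIsBdd ht (s := t) (t := s) hs x
        rw [add_comm t s] at this
        exact this
    _ = ∫ s in Ioi t, heatFlow s f x := by
        have := (measurePreserving_add_right volume t).setIntegral_preimage_emb
          (measurableEmbedding_addRight t) (fun s => heatFlow s f x) (Ioi t)
        rwa [preimage_add_const_Ioi, sub_self] at this

lemma IsDensity.pot_sub_heatFlow_pot (hf : IsDensity M f) (ht : 0 < t) (x : E3) :
    pot f x - heatFlow t (pot f) x = ∫ s in Ioc 0 t, heatFlow s f x := by
  rw [hf.pot_eq, hf.heatFlow_pot ht, ← Ioc_union_Ioi_eq_Ioi ht.le,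
    setIntegral_union (Ioc_disjoint_Ioi le_rfl) measurableSet_Ioi
      ((hf.integrableOn_heatFlow x).mono_set Ioc_subset_Ioi_self)
      ((hf.integrableOn_heatFlow x).mono_set (Ioi_subset_Ioi ht.le))]
  ring

end Flow

section Energy

open Set Filter Topology

variable {M N s t c : ℝ} {f g h : E3 → ℝ}

lemma IsDensity.add_const_mul (hf : IsDensity M f) (hg : IsDensity N g) (c : ℝ) :
    IsDensity (M + |c| * N) (fun x => f x + c * g x) where
  meas := hf.meas.add (hg.meas.const_mul c)
  int := hf.int.add (hg.int.const_mul c)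
  bdd := by
    filter_upwards [hf.bdd, hg.bdd] with x h1 h2
    refine (abs_add_le _ _).trans (add_le_add h1 ?_)
    rw [abs_mul]
    exact mul_le_mul_of_nonneg_left h2 (abs_nonneg _)

lemma pot_add_const_mul (hf : IsDensity M f) (hg : IsDensity N g) (c : ℝ) (x : E3) :
    pot (fun x => f x + c * g x) x = pot f x + c * pot g x := by
  unfold pot
  rw [← integral_const_mul, ← integral_add (hf.integrable_coul_mul x)
    ((hg.integrable_coul_mul x).const_mul c)]
  exact integral_congr_ae (ae_of_all _ fun y => by ring)

/-- The Coulomb inner product of two densities. -/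
def coulInner (f g : E3 → ℝ) : ℝ := ∫ x, f x * pot g x

lemma integrable_mul_pot (hf : Integrable f) (hg : IsDensity N g) :
    Integrable (fun x => f x * pot g x) := by
  refine Integrable.mono' (hf.norm.mul_const (potBound N g))
    (hf.1.mul hg.continuous_pot.aestronglyMeasurable) (ae_of_all _ fun x => ?_)
  rw [norm_mul]
  exact mul_le_mul_of_nonneg_left (hg.abs_pot_le x) (norm_nonneg _)

lemma integrable_mul_heatFlow_time (hf : IsDensity M f) (hg : IsDensity N g) :
    Integrable (Function.uncurry fun (x : E3) (s : ℝ) => f x * heatFlow s g x)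
      (volume.prod (volume.restrict (Ioi 0))) := by
  refine Integrable.mono' (hf.int.norm.mul_prod hg.integrableOn_timeBound) ?_ ?_
  · exact ((hf.meas.comp measurable_fst).mul
      ((measurable_heatFlow_uncurry hg.meas).comp measurable_swap)).aestronglyMeasurable
  · have : ∀ᵐ p : E3 × ℝ ∂(volume.prod (volume.restrict (Ioi 0))), p.2 ∈ Ioi (0 : ℝ) :=
      Measure.quasiMeasurePreserving_snd.ae (ae_restrict_mem measurableSet_Ioi)
    filter_upwards [this] with p hp
    rw [Function.uncurry, norm_mul]
    exact mul_le_mul_of_nonneg_left (hg.abs_heatFlow_le_timeBound hp _) (norm_nonneg _)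

lemma integrableOn_integral_mul_heatFlow (hf : IsDensity M f) (hg : IsDensity N g) :
    IntegrableOn (fun s => ∫ x, f x * heatFlow s g x) (Ioi 0) :=
  (integrable_mul_heatFlow_time hf hg).integral_prod_right

lemma coulInner_eq (hf : IsDensity M f) (hg : IsDensity N g) :
    coulInner f g = ∫ s in Ioi 0, ∫ x, f x * heatFlow s g x := by
  have := integral_integral_swap (integrable_mul_heatFlow_time hf hg)
  rw [← this]
  simp only [coulInner, hg.pot_eq, integral_const_mul]

lemma coulInner_comm (hf : IsDensity M f) (hg : IsDensity N g) :
    coulInner f g = coulInner g f := by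
  rw [coulInner_eq hf hg, coulInner_eq hg hf]
  refine setIntegral_congr_fun measurableSet_Ioi fun s hs => ?_
  rw [integral_mul_heatFlow hf.int hf.meas hg.toIsBdd hs]
  exact integral_congr_ae (ae_of_all _ fun x => mul_comm _ _)

lemma integral_mul_heatFlow_self (hf : IsDensity M f) (hs : 0 < s) :
    ∫ x, f x * heatFlow s f x = ∫ x, heatFlow (s / 2) f x * heatFlow (s / 2) f x := by
  rw [← integral_mul_heatFlow hf.int hf.meas (hf.toIsBdd.isBdd_heatFlow (half_pos hs))
    (half_pos hs)]
  refine integral_congr_ae (ae_of_all _ fun x => ?_)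
  simp only [heatFlow_heatFlow hf.toIsBdd (half_pos hs) (half_pos hs), add_halves]

lemma integral_mul_heatFlow_self_nonneg (hf : IsDensity M f) (hs : 0 < s) :
    0 ≤ ∫ x, f x * heatFlow s f x := by
  rw [integral_mul_heatFlow_self hf hs]
  exact integral_nonneg fun x => mul_self_nonneg _

lemma coulInner_self_nonneg (hf : IsDensity M f) : 0 ≤ coulInner f f := by
  rw [coulInner_eq hf hf]
  exact setIntegral_nonneg measurableSet_Ioi fun s hs => integral_mul_heatFlow_self_nonneg hf hs

lemma coulInner_add_const_mul (hf : IsDensity M f) (hg : IsDensity N g) (c : ℝ) :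
    coulInner (fun x => f x + c * g x) (fun x => f x + c * g x) =
      coulInner f f + 2 * c * coulInner g f + c ^ 2 * coulInner g g := by
  have h1 : coulInner (fun x => f x + c * g x) (fun x => f x + c * g x) =
      coulInner f f + c * coulInner f g + c * coulInner g f + c ^ 2 * coulInner g g := by
    unfold coulInner
    simp only [pot_add_const_mul hf hg]
    simp only [← integral_const_mul]
    rw [← integral_add, ← integral_add, ← integral_add]
    · exact integral_congr_ae (ae_of_all _ fun x => by ring)
    all_goals
      have i1 := integrable_mul_pot hf.int hf
      have i2 := (integrable_mul_pot hf.int hg).const_mul c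
      have i3 := (integrable_mul_pot hg.int hf).const_mul c
      have i4 := (integrable_mul_pot hg.int hg).const_mul (c ^ 2)
    · exact (i1.add i2).add i3
    · exact i4
    · exact i1.add i2
    · exact i3
    · exact i1
    · exact i2
  rw [h1, coulInner_comm hf hg]
  ring

lemma coulInner_congr {f' g' : E3 → ℝ} (hf : f =ᵐ[volume] f') (hg : g =ᵐ[volume] g') :
    coulInner f g = coulInner f' g' := by
  unfold coulInner
  rw [pot_congr hg]
  exact integral_congr_ae (hf.mono fun x hx => by simp only [hx])

lemma const_rpow_le (ht : 0 < t) :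
    (4 * π * t) ^ (-(3 / 2) : ℝ) ≤ 4 * (4 * π * (2 * t)) ^ (-(3 / 2) : ℝ) := by
  have h2 : (4 : ℝ)⁻¹ ≤ (2 : ℝ) ^ (-(3 / 2) : ℝ) := by
    have : (4 : ℝ)⁻¹ = (2 : ℝ) ^ (-2 : ℝ) := by
      rw [rpow_neg (by norm_num)]; norm_num
    rw [this]
    exact rpow_le_rpow_of_exponent_le (by norm_num) (by norm_num)
  have h3 : (4 * π * (2 * t)) ^ (-(3 / 2) : ℝ) =
      (2 : ℝ) ^ (-(3 / 2) : ℝ) * (4 * π * t) ^ (-(3 / 2) : ℝ) := by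
    rw [← mul_rpow (by norm_num) (by positivity)]; congr 1; ring
  have h4 : 0 < (4 * π * t) ^ (-(3 / 2) : ℝ) := by positivity
  rw [h3]
  nlinarith

lemma norm_sq_mul_heat_le (ht : 0 < t) (z : E3) :
    ‖z‖ ^ 2 * heat t z ≤ 32 * t * heat (2 * t) z := by
  unfold heat
  set r := ‖z‖ ^ 2 / (8 * t) with hr
  have e0 : ‖z‖ ^ 2 = 8 * t * r := by rw [hr]; field_simp
  have e1 : ‖z‖ ^ 2 / (4 * t) = r + r := by rw [hr]; field_simp; ring
  have e2 : ‖z‖ ^ 2 / (4 * (2 * t)) = r := by rw [hr]; congr 1; ring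
  rw [e1, e2, neg_add, Real.exp_add, e0]
  have hr0 : 0 ≤ r := by positivity
  have h1 : r * rexp (-r) ≤ 1 := by
    rw [Real.exp_neg, ← div_eq_mul_inv, div_le_one (Real.exp_pos _)]
    linarith [Real.add_one_le_exp r]
  have h2 := const_rpow_le ht
  have h3 : 0 < rexp (-r) := Real.exp_pos _
  have h4 : 0 < (4 * π * t) ^ (-(3 / 2) : ℝ) := by positivity
  calc 8 * t * r * ((4 * π * t) ^ (-(3 / 2) : ℝ) * (rexp (-r) * rexp (-r)))
      = 8 * t * (r * rexp (-r)) * ((4 * π * t) ^ (-(3 / 2) : ℝ) * rexp (-r)) := by ring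
    _ ≤ 8 * t * 1 * ((4 * (4 * π * (2 * t)) ^ (-(3 / 2) : ℝ)) * rexp (-r)) := by gcongr
    _ = _ := by ring

lemma heat_le_heat_shift (ht : 0 < t) {x y z : E3} (h : ‖x - y‖ ^ 2 ≤ t) :
    heat t (y - z) ≤ 8 * heat (2 * t) (x - z) := by
  unfold heat
  have h2 := const_rpow_le ht
  have h4 : 0 < (4 * π * t) ^ (-(3 / 2) : ℝ) := by positivity
  have h5 : ‖x - z‖ ^ 2 ≤ 2 * t + 2 * ‖y - z‖ ^ 2 := by
    have : ‖x - z‖ ≤ ‖x - y‖ + ‖y - z‖ := norm_sub_le_norm_sub_add_norm_sub x y z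
    nlinarith [norm_nonneg (x - z), norm_nonneg (x - y), norm_nonneg (y - z),
      sq_nonneg (‖x - y‖ - ‖y - z‖)]
  have h6 : -(‖y - z‖ ^ 2 / (4 * t)) ≤ 1 / 4 + -(‖x - z‖ ^ 2 / (4 * (2 * t))) := by
    have : 1 / 4 + -(‖x - z‖ ^ 2 / (4 * (2 * t))) - -(‖y - z‖ ^ 2 / (4 * t)) =
        (2 * t + 2 * ‖y - z‖ ^ 2 - ‖x - z‖ ^ 2) / (8 * t) := by field_simp; ring
    have h7 : 0 ≤ (2 * t + 2 * ‖y - z‖ ^ 2 - ‖x - z‖ ^ 2) / (8 * t) :=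
      div_nonneg (by linarith) (by positivity)
    linarith
  have h8 : rexp (1 / 4) ≤ 2 := by
    have := Real.exp_one_lt_d9
    have h9 : rexp (1 / 4) ^ 4 = rexp 1 := by rw [← Real.exp_nat_mul]; norm_num
    by_contra hh
    push Not at hh
    have : (2 : ℝ) ^ 4 ≤ rexp (1 / 4) ^ 4 := by gcongr
    linarith
  calc (4 * π * t) ^ (-(3 / 2) : ℝ) * rexp (-(‖y - z‖ ^ 2 / (4 * t)))
      ≤ (4 * (4 * π * (2 * t)) ^ (-(3 / 2) : ℝ)) *
          rexp (1 / 4 + -(‖x - z‖ ^ 2 / (4 * (2 * t)))) := by gcongr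
    _ = (4 * (4 * π * (2 * t)) ^ (-(3 / 2) : ℝ)) *
          (rexp (1 / 4) * rexp (-(‖x - z‖ ^ 2 / (4 * (2 * t))))) := by rw [Real.exp_add]
    _ ≤ (4 * (4 * π * (2 * t)) ^ (-(3 / 2) : ℝ)) *
          (2 * rexp (-(‖x - z‖ ^ 2 / (4 * (2 * t))))) := by gcongr
    _ = _ := by ring

/-- Short-time lower bound for the heat flow from a local lower bound on the initial datum. -/
lemma IsBdd.eventually_heatFlow_ge (hh : IsBdd M h) {x : E3} {δ ε : ℝ} (hδ : 0 < δ)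
    (hε : 0 < ε) (hc : ∀ᵐ y, ‖x - y‖ < δ → c ≤ h y) :
    ∀ᶠ s in 𝓝[>] (0 : ℝ), c - ε ≤ heatFlow s h x := by
  set K := (M + |c|) * (32 / δ ^ 2) with hK
  have hM := hh.nonneg
  have hlim : ∀ᶠ s in 𝓝[>] (0 : ℝ), K * s < ε := by
    have : Tendsto (fun s : ℝ => K * s) (𝓝[>] 0) (𝓝 (K * 0)) :=
      (continuous_const.mul continuous_id).tendsto' _ _ rfl |>.mono_left nhdsWithin_le_nhds
    rw [mul_zero] at this
    exact this.eventually_lt_const hε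
  filter_upwards [hlim, self_mem_nhdsWithin] with s h1 hs
  have hs : 0 < s := hs
  have key : ∫ y, (c * heat s (x - y) - K * s * heat (2 * s) (x - y)) ≤ heatFlow s h x := by
    refine integral_mono_ae (((integrable_heat_sub hs x).const_mul c).sub
      ((integrable_heat_sub (by positivity) x).const_mul _)) (hh.integrable_heat_mul hs x) ?_
    filter_upwards [hc, hh.bdd] with y hy hb
    have p1 := heat_pos hs (x - y)
    have p2 := heat_pos (t := 2 * s) (by positivity) (x - y)
    by_cases hd : ‖x - y‖ < δ
    · have := hy hd
      have : 0 ≤ K * s * heat (2 * s) (x - y) := by positivity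
      nlinarith
    · push Not at hd
      have q1 := norm_sq_mul_heat_le hs (x - y)
      have q2 : δ ^ 2 * heat s (x - y) ≤ 32 * s * heat (2 * s) (x - y) :=
        le_trans (by gcongr) q1
      have q3 : heat s (x - y) ≤ 32 / δ ^ 2 * s * heat (2 * s) (x - y) := by
        rw [div_mul_eq_mul_div, div_mul_eq_mul_div, le_div_iff₀ (by positivity)]
        linarith
      have q4 : c - h y ≤ M + |c| := by
        have := neg_abs_le (h y)
        have := le_abs_self c
        linarith
      have q5 : (c - h y) * heat s (x - y) ≤ (M + |c|) * heat s (x - y) := by gcongr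
      have q6 : (M + |c|) * heat s (x - y) ≤
          (M + |c|) * (32 / δ ^ 2 * s * heat (2 * s) (x - y)) := by gcongr
      have q7 : K * s * heat (2 * s) (x - y) =
          (M + |c|) * (32 / δ ^ 2 * s * heat (2 * s) (x - y)) := by rw [hK]; ring
      linarith
  rw [integral_sub ((integrable_heat_sub hs x).const_mul c)
    ((integrable_heat_sub (by positivity) x).const_mul _), integral_const_mul, integral_const_mul,
    integral_heat_sub hs, integral_heat_sub (by positivity)] at key
  linarith

lemma heatFlow_neg (t : ℝ) (f : E3 → ℝ) (x : E3) :
    heatFlow t (fun y => -f y) x = -heatFlow t f x := by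
  simp [heatFlow, integral_neg]

lemma IsBdd.neg (hf : IsBdd M f) : IsBdd M (fun x => -f x) := ⟨hf.meas.neg, by simpa using hf.bdd⟩

lemma IsBdd.tendsto_heatFlow (hh : IsBdd M h) {x : E3} (hc : ContinuousAt h x) :
    Tendsto (fun s => heatFlow s h x) (𝓝[>] 0) (𝓝 (h x)) := by
  rw [Metric.tendsto_nhds]
  intro ε hε
  obtain ⟨δ, hδ, hd⟩ := Metric.continuousAt_iff.1 hc (ε / 4) (by positivity)
  have hd' : ∀ y, ‖x - y‖ < δ → |h y - h x| < ε / 4 := fun y hy => by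
    have := hd (x := y) (by rw [dist_eq_norm, norm_sub_rev]; exact hy)
    rwa [Real.dist_eq] at this
  have h1 := hh.eventually_heatFlow_ge (x := x) (c := h x - ε / 4) hδ (ε := ε / 4) (by positivity)
    (ae_of_all _ fun y hy => by have := (abs_lt.1 (hd' y hy)).1; linarith)
  have h2 := hh.neg.eventually_heatFlow_ge (x := x) (c := -h x - ε / 4) hδ (ε := ε / 4)
    (by positivity) (ae_of_all _ fun y hy => by have := (abs_lt.1 (hd' y hy)).2; linarith)
  filter_upwards [h1, h2] with s h1 h2
  rw [heatFlow_neg] at h2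
  rw [Real.dist_eq, abs_lt]
  constructor <;> linarith

lemma integral_heatFlow (hf : IsDensity M f) (ht : 0 < t) : ∫ x, heatFlow t f x = ∫ x, f x := by
  have h1 : IsBdd 1 (fun _ : E3 => (1 : ℝ)) := ⟨measurable_const, by simp⟩
  have := integral_mul_heatFlow hf.int hf.meas h1 ht
  simp only [mul_one] at this
  rw [← this]
  refine integral_congr_ae (ae_of_all _ fun x => ?_)
  simp [heatFlow, integral_heat_sub ht]

lemma heatFlow_nonneg (hf : ∀ x, 0 ≤ f x) (ht : 0 < t) (x : E3) : 0 ≤ heatFlow t f x :=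
  integral_nonneg fun y => mul_nonneg (heat_pos ht _).le (hf y)

/-- `L¹` continuity of the heat flow at time zero, for non-negative continuous data. -/
lemma tendsto_integral_abs_heatFlow_sub (hg : IsDensity M g) (hgc : Continuous g)
    (hg0 : ∀ x, 0 ≤ g x) :
    Tendsto (fun s => ∫ x, |heatFlow s g x - g x|) (𝓝[>] 0) (𝓝 0) := by
  have h1 : Tendsto (fun s => ∫ x, max (g x - heatFlow s g x) 0) (𝓝[>] 0) (𝓝 (∫ x : E3, 0)) := by
    refine tendsto_integral_filter_of_dominated_convergence g
      (Eventually.of_forall fun s => ?_) ?_ hg.int (ae_of_all _ fun x => ?_)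
    · exact ((hg.meas.sub (measurable_heatFlow hg.meas s)).max measurable_const).aestronglyMeasurable
    · filter_upwards [self_mem_nhdsWithin] with s hs
      refine ae_of_all _ fun x => ?_
      rw [Real.norm_of_nonneg (le_max_right _ _)]
      exact max_le (by linarith [heatFlow_nonneg hg0 hs x]) (hg0 x)
    · have := (tendsto_const_nhds (x := g x)).sub
        (hg.toIsBdd.tendsto_heatFlow (x := x) hgc.continuousAt)
      have := this.max (tendsto_const_nhds (x := (0 : ℝ)))
      simpa using this
  have h2 := h1.const_mul 2
  simp only [integral_zero, mul_zero] at h2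
  refine h2.congr' ?_
  filter_upwards [self_mem_nhdsWithin] with s hs
  have i1 : Integrable (fun x => g x - heatFlow s g x) := hg.int.sub (hg.integrable_heatFlow hs)
  have e1 : ∫ x, (g x - heatFlow s g x) = 0 := by
    rw [integral_sub hg.int (hg.integrable_heatFlow hs), integral_heatFlow hg hs, sub_self]
  have e2 : ∀ x, |heatFlow s g x - g x| =
      2 * max (g x - heatFlow s g x) 0 - (g x - heatFlow s g x) := fun x => by
    rcases le_total (g x) (heatFlow s g x) with h | h
    · rw [abs_of_nonneg (by linarith), max_eq_right (by linarith)]; ring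
    · rw [abs_of_nonpos (by linarith), max_eq_left (by linarith)]; ring
  simp only [e2]
  rw [integral_sub (i1.pos_part.const_mul 2) i1, e1, integral_const_mul, sub_zero]

end Energy

section Properties

open Set Filter Topology

variable {M N s t c : ℝ} {f g h : E3 → ℝ}

lemma Integrable.mul_isBdd (hf : Integrable f) (hh : IsBdd M h) :
    Integrable (fun x => f x * h x) :=
  hf.mul_bdd hh.meas.aestronglyMeasurable hh.bdd

lemma abs_integral_mul_le (hf : Integrable f) (hh : IsBdd M h) :
    |∫ x, f x * h x| ≤ M * ∫ x, |f x| := by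
  rw [← integral_const_mul, ← norm_eq_abs]
  refine norm_integral_le_of_norm_le (hf.abs.const_mul _) ?_
  filter_upwards [hh.bdd] with x hx
  rw [norm_mul, mul_comm]
  exact mul_le_mul_of_nonneg_right hx (abs_nonneg _)

lemma tendsto_integral_mul_heatFlow_of_nonneg (hg : IsDensity N g) (hgc : Continuous g)
    (hg0 : ∀ x, 0 ≤ g x) (hh : IsBdd M h) :
    Tendsto (fun s => ∫ x, g x * heatFlow s h x) (𝓝[>] 0) (𝓝 (∫ x, g x * h x)) := by
  rw [tendsto_iff_norm_sub_tendsto_zero]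
  have h1 := (tendsto_integral_abs_heatFlow_sub hg hgc hg0).const_mul M
  rw [mul_zero] at h1
  refine squeeze_zero' (Eventually.of_forall fun s => norm_nonneg _) ?_ h1
  filter_upwards [self_mem_nhdsWithin] with s hs
  have i1 := hg.integrable_heatFlow hs
  rw [integral_mul_heatFlow hg.int hg.meas hh hs, ← integral_sub (Integrable.mul_isBdd i1 hh)
    (Integrable.mul_isBdd hg.int hh)]
  simp only [← sub_mul]
  exact abs_integral_mul_le (i1.sub hg.int) hh

lemma isDensity_of_hasCompactSupport (hgc : Continuous g) (hs : HasCompactSupport g) :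
    ∃ N, IsDensity N g := by
  obtain ⟨N, hN⟩ := hs.exists_bound_of_continuous hgc
  exact ⟨N, ⟨hgc.measurable, ae_of_all _ hN⟩, hgc.integrable_of_hasCompactSupport hs⟩

lemma tendsto_integral_mul_heatFlow_of_hasCompactSupport (hgc : Continuous g)
    (hs : HasCompactSupport g) (hh : IsBdd M h) :
    Tendsto (fun s => ∫ x, g x * heatFlow s h x) (𝓝[>] 0) (𝓝 (∫ x, g x * h x)) := by
  have c1 : Continuous (fun x => max (g x) 0) := by fun_prop
  have c2 : Continuous (fun x => max (-g x) 0) := by fun_prop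
  obtain ⟨N1, d1⟩ := isDensity_of_hasCompactSupport c1
    (hs.comp_left (g := fun r : ℝ => max r 0) (by simp))
  obtain ⟨N2, d2⟩ := isDensity_of_hasCompactSupport c2
    (hs.comp_left (g := fun r : ℝ => max (-r) 0) (by simp))
  have t1 := tendsto_integral_mul_heatFlow_of_nonneg d1 c1 (fun _ => le_max_right _ _) hh
  have t2 := tendsto_integral_mul_heatFlow_of_nonneg d2 c2 (fun _ => le_max_right _ _) hh
  have key : ∀ u : E3 → ℝ, IsBdd M u →
      (∫ x, max (g x) 0 * u x) - (∫ x, max (-g x) 0 * u x) = ∫ x, g x * u x := fun u hu => by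
    rw [← integral_sub (Integrable.mul_isBdd d1.int hu) (Integrable.mul_isBdd d2.int hu)]
    refine integral_congr_ae (ae_of_all _ fun x => ?_)
    simp only [← sub_mul]
    rw [max_zero_sub_max_neg_zero_eq_self]
  have t3 := t1.sub t2
  rw [key h hh] at t3
  refine t3.congr' ?_
  filter_upwards [self_mem_nhdsWithin] with s hs
  exact key _ (hh.isBdd_heatFlow hs)

/-- Weak continuity of the heat flow at time zero for bounded data. -/
lemma IsBdd.tendsto_integral_mul_heatFlow (hh : IsBdd M h) (hf : Integrable f) :
    Tendsto (fun s => ∫ x, f x * heatFlow s h x) (𝓝[>] 0) (𝓝 (∫ x, f x * h x)) := by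
  have hM := hh.nonneg
  rw [Metric.tendsto_nhds]
  intro ε hε
  have hM1 : 0 < 4 * (M + 1) := by positivity
  obtain ⟨g, hs, hfg, hgc, hg⟩ := hf.exists_hasCompactSupport_integral_sub_le (div_pos hε hM1)
  have est : ∀ u : E3 → ℝ, IsBdd M u →
      |(∫ x, f x * u x) - ∫ x, g x * u x| ≤ ε / 4 := fun u hu => by
    rw [← integral_sub (Integrable.mul_isBdd hf hu) (Integrable.mul_isBdd hg hu)]
    simp only [← sub_mul]
    refine (abs_integral_mul_le (hf.sub hg) hu).trans ?_
    calc M * ∫ x, |(f - g) x| ≤ (M + 1) * (ε / (4 * (M + 1))) := by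
          refine mul_le_mul (by linarith) hfg (integral_nonneg fun _ => abs_nonneg _) (by linarith)
      _ = ε / 4 := by field_simp
  have ht := Metric.tendsto_nhds.1
    (tendsto_integral_mul_heatFlow_of_hasCompactSupport hgc hs hh) (ε / 4) (by positivity)
  filter_upwards [ht, self_mem_nhdsWithin] with s h1 hs
  have h2 := est _ (hh.isBdd_heatFlow hs)
  have h3 := est _ hh
  rw [Real.dist_eq] at *
  rw [abs_lt] at *
  rw [abs_le] at h2 h3
  constructor <;> linarith [h1.1, h1.2, h2.1, h2.2, h3.1, h3.2]

/-- The Coulomb form is strictly positive. -/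
lemma ae_eq_zero_of_coulInner_self_eq_zero (hf : IsDensity M f) (h0 : coulInner f f = 0) :
    f =ᵐ[volume] 0 := by
  rw [coulInner_eq hf hf, setIntegral_eq_zero_iff_of_nonneg_ae
    (by filter_upwards [ae_restrict_mem measurableSet_Ioi] with s hs using
      integral_mul_heatFlow_self_nonneg hf hs)
    (integrableOn_integral_mul_heatFlow hf hf)] at h0
  have h1 := hf.toIsBdd.tendsto_integral_mul_heatFlow hf.int
  have h2 : ∃ᶠ s in 𝓝[>] (0 : ℝ), ∫ x, f x * heatFlow s f x = 0 := by
    intro hcon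
    obtain ⟨δ, hδ, hd⟩ := mem_nhdsGT_iff_exists_Ioo_subset.1 hcon
    have h3 : ∀ᵐ s ∂(volume.restrict (Ioo 0 δ)), (False : Prop) := by
      filter_upwards [ae_restrict_mem measurableSet_Ioo,
        ae_restrict_of_ae_restrict_of_subset Ioo_subset_Ioi_self h0] with s h4 h5
      exact hd h4 h5
    have hδ : (0 : ℝ) < δ := hδ
    have : volume (Ioo 0 δ) = 0 := by
      rwa [eventually_false_iff_eq_bot, ae_eq_bot, Measure.restrict_eq_zero] at h3
    simp only [Real.volume_Ioo, ENNReal.ofReal_eq_zero] at this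
    linarith
  have h3 : ∫ x, f x * f x = 0 := by
    by_contra hne
    obtain ⟨s, hs⟩ := (h2.and_eventually (h1.eventually_ne hne)).exists
    exact hs.2 hs.1
  rw [integral_eq_zero_iff_of_nonneg (fun x => mul_self_nonneg _)
    (Integrable.mul_isBdd hf.int hf.toIsBdd)] at h3
  filter_upwards [h3] with x hx
  exact mul_self_eq_zero.1 hx

end Properties

section MaxPrinciple

open Set Filter Topology

variable {M N s t c : ℝ} {f g h : E3 → ℝ}

lemma IsBdd.le_heatFlow (hh : IsBdd M h) (ht : 0 < t) (hc : ∀ y, c ≤ h y) (x : E3) :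
    c ≤ heatFlow t h x := by
  have h1 : ∫ y, heat t (x - y) * c = c := by
    rw [integral_mul_const, integral_heat_sub ht, one_mul]
  rw [← h1]
  exact integral_mono ((integrable_heat_sub ht x).mul_const c) (hh.integrable_heat_mul ht x)
    fun y => mul_le_mul_of_nonneg_left (hc y) (heat_pos ht _).le

/-- If the density is non-negative wherever its potential is negative, then the potential is
non-negative everywhere. -/
lemma IsDensity.pot_nonneg (hf : IsDensity M f) (hneg : ∀ᵐ x, pot f x < 0 → 0 ≤ f x) (x : E3) :
    0 ≤ pot f x := by
  by_contra! hx
  have hg : IsDensity ((4 * π * 1) ^ (-(3 / 2) : ℝ)) (heat 1) :=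
    ⟨⟨(continuous_heat 1).measurable, ae_of_all _ fun y => by
      rw [abs_of_pos (heat_pos one_pos y)]; exact heat_le one_pos y⟩, integrable_heat one_pos⟩
  set C := potBound ((4 * π * 1) ^ (-(3 / 2) : ℝ)) (heat 1) with hC
  have hg1 : ∀ y, pot (heat 1) y ≤ C := fun y => (le_abs_self _).trans (hg.abs_pot_le y)
  have hg0 : ∀ y, 0 ≤ pot (heat 1) y := fun y =>
    integral_nonneg fun z => mul_nonneg (coul_nonneg y z) (heat_pos one_pos z).le
  have hC0 : 0 ≤ C := (hg0 0).trans (hg1 0)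
  set ε := -pot f x / (2 * (C + 1)) with hε
  have hε0 : 0 < ε := div_pos (by linarith) (by linarith)
  have hε1 : ε * C < -pot f x := by
    rw [hε, div_mul_eq_mul_div, div_lt_iff₀ (by linarith)]
    nlinarith
  have hρ := hf.add_const_mul hg ε
  have hpot := pot_add_const_mul hf hg ε
  set ρ := fun y => f y + ε * heat 1 y with hρdef
  have hx1 : pot ρ x < 0 := by
    rw [hpot]
    nlinarith [hg1 x]
  obtain ⟨x₀, hx₀⟩ := hρ.continuous_pot.exists_forall_le' x
    ((hρ.tendsto_pot.eventually_const_lt hx1).mono fun y hy => hy.le)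
  have hx2 : pot f x₀ < 0 := by
    have := hx₀ x
    rw [hpot x₀] at this
    nlinarith [hg0 x₀]
  have hp := heat_pos one_pos x₀
  have hnear : ∀ᶠ y in 𝓝 x₀, pot f y < 0 ∧ heat 1 x₀ / 2 < heat 1 y :=
    (hf.continuous_pot.continuousAt.eventually_lt_const hx2).and
      ((continuous_heat 1).continuousAt.eventually_const_lt (half_lt_self hp))
  obtain ⟨δ, hδ, hd⟩ := Metric.eventually_nhds_iff.1 hnear
  have hev := hρ.toIsBdd.eventually_heatFlow_ge (x := x₀) hδ (c := ε * (heat 1 x₀ / 2))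
    (ε := ε * (heat 1 x₀ / 4)) (by positivity) (by
      filter_upwards [hneg] with y hy hxy
      have := hd (y := y) (by rw [dist_eq_norm, norm_sub_rev]; exact hxy)
      have h1 := hy this.1
      have h2 : ε * (heat 1 x₀ / 2) ≤ ε * heat 1 y := by gcongr; exact this.2.le
      simp only [hρdef]
      linarith)
  obtain ⟨t, ht, hIoc⟩ := mem_nhdsGT_iff_exists_Ioc_subset.1 hev
  have ht : 0 < t := ht
  have h1 := hρ.pot_sub_heatFlow_pot ht x₀
  have h2 := hρ.isBdd_pot.le_heatFlow ht hx₀ x₀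
  have h3 : ∫ s in Ioc 0 t, ε * (heat 1 x₀ / 4) ≤ ∫ s in Ioc 0 t, heatFlow s ρ x₀ := by
    refine setIntegral_mono_on (integrableOn_const (by simp)) ((hρ.integrableOn_heatFlow x₀).mono_set
      Ioc_subset_Ioi_self) measurableSet_Ioc fun s hs => ?_
    have : ε * (heat 1 x₀ / 2) - ε * (heat 1 x₀ / 4) ≤ heatFlow s ρ x₀ := hIoc hs
    linarith
  have h4 : 0 < ∫ s in Ioc 0 t, ε * (heat 1 x₀ / 4) := by
    rw [setIntegral_const, smul_eq_mul, Real.volume_real_Ioc_of_le ht.le, sub_zero]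
    positivity
  linarith

lemma IsDensity.abs_pot_sub_heatFlow_pot_le (hf : IsDensity M f) (ht : 0 < t) (x : E3) :
    |pot f x - heatFlow t (pot f) x| ≤ M * t := by
  rw [hf.pot_sub_heatFlow_pot ht, ← norm_eq_abs]
  refine (norm_setIntegral_le_of_norm_le_const (C := M) (by simp) fun s hs =>
    hf.toIsBdd.abs_heatFlow_le hs.1 x).trans (le_of_eq ?_)
  rw [Real.volume_real_Ioc_of_le ht.le, sub_zero]

/-- Quadratic growth of a non-negative potential away from its zeros. -/
lemma IsDensity.pot_le_norm_sq (hf : IsDensity 1 f) (h0 : ∀ x, 0 ≤ pot f x) {x : E3}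
    (hx : pot f x = 0) (y : E3) : pot f y ≤ 17 * ‖x - y‖ ^ 2 := by
  rcases eq_or_ne x y with rfl | hxy
  · simp [hx]
  set t := ‖x - y‖ ^ 2 with ht
  have ht0 : 0 < t := by
    have := norm_pos_iff.2 (sub_ne_zero.2 hxy)
    positivity
  have h1 := (abs_le.1 (hf.abs_pot_sub_heatFlow_pot_le ht0 y)).2
  have h2 := (abs_le.1 (hf.abs_pot_sub_heatFlow_pot_le (t := 2 * t) (by positivity) x)).1
  have h3 : heatFlow t (pot f) y ≤ 8 * heatFlow (2 * t) (pot f) x := by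
    unfold heatFlow
    rw [← integral_const_mul]
    refine integral_mono (hf.isBdd_pot.integrable_heat_mul ht0 y)
      ((hf.isBdd_pot.integrable_heat_mul (by positivity) x).const_mul 8) fun z => ?_
    have := mul_le_mul_of_nonneg_right (heat_le_heat_shift (x := x) (y := y) (z := z) ht0 le_rfl)
      (h0 z)
    simp only
    linarith
  linarith

lemma IsDensity.heatFlow_pot_le (hf : IsDensity 1 f) (h0 : ∀ x, 0 ≤ pot f x) {x : E3}
    (hx : pot f x = 0) (ht : 0 < t) (hh : IsBdd 1 h) (h1 : ∀ y, pot f y ≠ 0 → h y = 1)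
    (h2 : ∀ y, 0 ≤ h y) :
    heatFlow t (pot f) x ≤ 544 * t * heatFlow (2 * t) h x := by
  unfold heatFlow
  rw [← integral_const_mul]
  refine integral_mono (hf.isBdd_pot.integrable_heat_mul ht x)
      ((hh.integrable_heat_mul (by positivity) x).const_mul _) fun y => ?_
  have p1 := heat_pos ht (x - y)
  have p2 := heat_pos (t := 2 * t) (by positivity) (x - y)
  have h3 := h2 y
  by_cases hy : pot f y = 0
  · simp only [hy, mul_zero]
    positivity
  · simp only [h1 y hy, mul_one]
    have q1 := norm_sq_mul_heat_le ht (x - y)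
    have q2 := hf.pot_le_norm_sq h0 hx y
    have q3 : heat t (x - y) * pot f y ≤ heat t (x - y) * (17 * ‖x - y‖ ^ 2) := by gcongr
    linarith

lemma setIntegral_integral_mul_heatFlow (hf : IsDensity M f) (hg : IsDensity N g) (ht : 0 < t) :
    ∫ s in Ioc 0 t, ∫ x, f x * heatFlow s g x =
      ∫ x, f x * (pot g x - heatFlow t (pot g) x) := by
  have hfi := (integrable_mul_heatFlow_time hf hg).mono_measure
    (Measure.prod_mono (le_refl volume)
      (Measure.restrict_mono (show Ioc 0 t ⊆ Ioi 0 from Ioc_subset_Ioi_self) le_rfl))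
  rw [← integral_integral_swap hfi]
  simp only [hg.pot_sub_heatFlow_pot ht, integral_const_mul]

/-- A density cannot be negative on a part of the zero set of its non-negative potential. -/
lemma IsDensity.ae_eq_zero_of_pot_eq_zero (hf : IsDensity 1 f) (h0 : ∀ x, 0 ≤ pot f x)
    {S : Set E3} (hS : MeasurableSet S) (hSZ : ∀ x ∈ S, pot f x = 0)
    (hfS : ∀ᵐ x, x ∈ S → f x ≤ 0) : ∀ᵐ x, x ∈ S → f x = 0 := by
  have hq : IsBdd 1 ({x | pot f x ≠ 0}.indicator fun _ => (1 : ℝ)) := by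
    refine ⟨measurable_const.indicator
      (hf.continuous_pot.measurable (measurableSet_singleton 0).compl), ae_of_all _ fun x => ?_⟩
    by_cases hx : pot f x = 0 <;> simp [hx]
  set q := {x | pot f x ≠ 0}.indicator fun _ => (1 : ℝ) with hqdef
  have hq1 : ∀ y, pot f y ≠ 0 → q y = 1 := fun y hy => by simp [hqdef, hy]
  have hq0 : ∀ y, 0 ≤ q y := fun y => indicator_nonneg (fun _ _ => zero_le_one) y
  have key : ∀ n : ℕ, ∀ᵐ x, x ∈ S ∩ Metric.ball 0 n → f x = 0 := fun n => by
    have hSn : MeasurableSet (S ∩ Metric.ball 0 (n : ℝ)) := hS.inter measurableSet_ball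
    set Sn := S ∩ Metric.ball (0 : E3) (n : ℝ) with hSndef
    have hk : IsDensity 1 (Sn.indicator fun _ => (1 : ℝ)) := by
      refine ⟨⟨measurable_const.indicator hSn, ae_of_all _ fun x => ?_⟩, ?_⟩
      · by_cases hx : x ∈ Sn <;> simp [hx]
      · exact (integrable_indicator_iff hSn).2 (integrableOn_const
          ((measure_mono inter_subset_right).trans_lt measure_ball_lt_top).ne)
    set k := Sn.indicator fun _ => (1 : ℝ) with hkdef
    have hk1 : ∀ x ∈ Sn, k x = 1 := fun x hx => by simp [hkdef, hx]
    have hk2 : ∀ x ∉ Sn, k x = 0 := fun x hx => by simp [hkdef, hx]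
    have hle : ∀ᵐ x, 0 ≤ -(k x * f x) := by
      filter_upwards [hfS] with x hx
      by_cases hxS : x ∈ Sn
      · rw [hk1 x hxS]; linarith [hx hxS.1]
      · simp [hk2 x hxS]
    have t1 := hf.toIsBdd.tendsto_integral_mul_heatFlow hk.int
    have t2 : Tendsto (fun t => ∫ x, k x * heatFlow (2 * t) q x) (𝓝[>] 0) (𝓝 0) := by
      have e : ∫ x, k x * q x = 0 := by
        refine integral_eq_zero_of_ae (ae_of_all _ fun x => ?_)
        by_cases hxS : x ∈ Sn
        · simp [hqdef, hSZ x hxS.1]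
        · simp [hk2 x hxS]
      have h1 := hq.tendsto_integral_mul_heatFlow hk.int
      rw [e] at h1
      refine h1.comp (tendsto_nhdsWithin_iff.2 ⟨?_, ?_⟩)
      · exact ((continuous_const.mul continuous_id).tendsto' _ _ (by simp)).mono_left
          nhdsWithin_le_nhds
      · filter_upwards [self_mem_nhdsWithin] with t ht
        have : (0 : ℝ) < t := ht
        simpa using this
    have ha : 0 ≤ ∫ x, k x * f x := by
      by_contra! ha
      set a := ∫ x, k x * f x
      have h3 : ∀ᶠ t in 𝓝[>] (0 : ℝ), 544 * ∫ x, k x * heatFlow (2 * t) q x < -a / 2 := by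
        have := t2.const_mul 544
        rw [mul_zero] at this
        exact this.eventually_lt_const (by linarith)
      obtain ⟨t₀, ht₀, hIoc⟩ := mem_nhdsGT_iff_exists_Ioc_subset.1
        (t1.eventually_lt_const (show a < a / 2 by linarith))
      obtain ⟨t, h4, ht⟩ := (h3.and (Ioc_mem_nhdsGT ht₀)).exists
      have h5 := setIntegral_integral_mul_heatFlow hk hf ht.1
      have h6 : ∫ s in Ioc 0 t, ∫ x, k x * heatFlow s f x ≤ ∫ s in Ioc 0 t, a / 2 := by
        refine setIntegral_mono_on ((integrableOn_integral_mul_heatFlow hk hf).mono_set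
          Ioc_subset_Ioi_self) (by simp) measurableSet_Ioc fun s hs => ?_
        exact (hIoc ⟨hs.1, hs.2.trans ht.2⟩).le
      simp only [setIntegral_const, smul_eq_mul, Real.volume_real_Ioc_of_le ht.1.le,
        sub_zero] at h6
      have h7 : ∫ x, -(544 * t * (k x * heatFlow (2 * t) q x)) ≤
          ∫ x, k x * (pot f x - heatFlow t (pot f) x) := by
        refine integral_mono ((Integrable.mul_isBdd hk.int (hq.isBdd_heatFlow
          (by linarith [ht.1]))).const_mul _).neg
          ?_ fun x => ?_
        · have := (Integrable.mul_isBdd hk.int hf.isBdd_pot).sub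
            (Integrable.mul_isBdd hk.int (hf.isBdd_pot.isBdd_heatFlow ht.1))
          refine this.congr (ae_of_all _ fun x => ?_)
          simp only [Pi.sub_apply, mul_sub]
        · by_cases hxS : x ∈ Sn
          · have := hf.heatFlow_pot_le h0 (hSZ x hxS.1) ht.1 hq hq1 hq0
            simp only [hk1 x hxS, one_mul, hSZ x hxS.1]
            linarith
          · simp [hk2 x hxS]
      rw [integral_neg, integral_const_mul] at h7
      nlinarith [ht.1]
    have hb : ∫ x, -(k x * f x) = 0 := by
      refine le_antisymm ?_ (integral_nonneg_of_ae hle)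
      rw [integral_neg]; linarith
    rw [integral_eq_zero_iff_of_nonneg_ae hle (Integrable.mul_isBdd hk.int hf.toIsBdd).neg] at hb
    filter_upwards [hb] with x hx hxS
    simpa [hk1 x hxS] using hx
  filter_upwards [ae_all_iff.2 key] with x hx hxS
  obtain ⟨n, hn⟩ := exists_nat_gt ‖x‖
  exact hx n ⟨hxS, by simpa using hn⟩

/-- A density whose potential has an integrable majorant has non-positive total charge. -/
lemma IsDensity.integral_nonpos_of_pot_le (hf : IsDensity M f) (hg : Integrable g)
    (h : ∀ x, pot f x ≤ g x) : ∫ x, f x ≤ 0 := by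
  by_contra! hQ
  set Q := ∫ x, f x with hQdef
  have hlim : Tendsto (fun s : ℝ => ∫ y, rexp (-(‖(0 : E3) - y‖ ^ 2 / (4 * s))) * f y) atTop
      (𝓝 Q) := by
    refine tendsto_integral_filter_of_dominated_convergence (fun y => |f y|)
      (Eventually.of_forall fun s => ?_) ?_ hf.int.abs (ae_of_all _ fun y => ?_)
    · exact (Continuous.aestronglyMeasurable (by fun_prop)).mul hf.int.1
    · filter_upwards [eventually_gt_atTop 0] with s hs
      refine ae_of_all _ fun y => ?_
      rw [norm_mul, Real.norm_of_nonneg (Real.exp_pos _).le]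
      refine mul_le_of_le_one_left (norm_nonneg _) (Real.exp_le_one_iff.2 ?_)
      have : 0 ≤ ‖(0 : E3) - y‖ ^ 2 / (4 * s) := by positivity
      linarith
    · have h1 : Tendsto (fun s : ℝ => ‖(0 : E3) - y‖ ^ 2 / (4 * s)) atTop (𝓝 0) :=
        tendsto_const_nhds.div_atTop (tendsto_id.const_mul_atTop (by norm_num))
      have h2 := (Real.continuous_exp.tendsto _).comp h1.neg
      rw [neg_zero, Real.exp_zero] at h2
      simpa using h2.mul_const (f y)
  obtain ⟨T, hT⟩ := eventually_atTop.1 (hlim.eventually_const_lt (half_lt_self hQ))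
  set K := ∫ y, |g y|
  have hK : 0 ≤ K := integral_nonneg fun _ => abs_nonneg _
  set t := max (max T 1) ((K + 1) / Q) with ht
  have ht0 : 0 < t := lt_of_lt_of_le one_pos ((le_max_right _ _).trans (le_max_left _ _))
  have htT : T ≤ t := (le_max_left _ _).trans (le_max_left _ _)
  have htK : K + 1 ≤ Q * t := by
    have : (K + 1) / Q ≤ t := le_max_right _ _
    rwa [div_le_iff₀' hQ] at this
  set A : ℝ := (4 * π) ^ (-(3 / 2) : ℝ) with hA
  have hA0 : 0 < A := by positivity
  have hr : ∀ s : ℝ, 0 < s → (4 * π * s) ^ (-(3 / 2) : ℝ) = A * s ^ (-(3 / 2) : ℝ) := fun s hs =>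
    mul_rpow (by positivity) hs.le
  have lower : A * (Q / 2) * (2 * t ^ (-(1 / 2) : ℝ)) ≤ heatFlow t (pot f) 0 := by
    rw [hf.heatFlow_pot ht0]
    have e : ∫ s in Ioi t, A * (Q / 2) * s ^ (-(3 / 2) : ℝ) =
        A * (Q / 2) * (2 * t ^ (-(1 / 2) : ℝ)) := by
      rw [integral_const_mul, integral_Ioi_rpow_of_lt (by norm_num) ht0]
      norm_num
      left
      ring
    rw [← e]
    refine setIntegral_mono_on ((integrableOn_Ioi_rpow_of_lt (by norm_num) ht0).const_mul _)
      ((hf.integrableOn_heatFlow 0).mono_set (Ioi_subset_Ioi ht0.le)) measurableSet_Ioi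
      fun s hs => ?_
    have hs : t < s := hs
    have h1 := hT s (htT.trans hs.le)
    have h2 : heatFlow s f 0 =
        A * s ^ (-(3 / 2) : ℝ) * ∫ y, rexp (-(‖(0 : E3) - y‖ ^ 2 / (4 * s))) * f y := by
      rw [← hr s (ht0.trans hs), ← integral_const_mul]
      simp only [heatFlow, heat, mul_assoc]
    rw [h2]
    have h3 : 0 < A * s ^ (-(3 / 2) : ℝ) := by have := ht0.trans hs; positivity
    nlinarith
  have upper : heatFlow t (pot f) 0 ≤ A * t ^ (-(3 / 2) : ℝ) * K := by
    rw [← hr t ht0, ← integral_const_mul]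
    refine integral_mono (hf.isBdd_pot.integrable_heat_mul ht0 0) (hg.abs.const_mul _) fun y => ?_
    calc heat t (0 - y) * pot f y ≤ heat t (0 - y) * |g y| :=
          mul_le_mul_of_nonneg_left ((h y).trans (le_abs_self _)) (heat_pos ht0 _).le
      _ ≤ _ := mul_le_mul_of_nonneg_right (heat_le ht0 _) (abs_nonneg _)
  have e2 : t ^ (-(1 / 2) : ℝ) = t * t ^ (-(3 / 2) : ℝ) := by
    rw [← Real.rpow_one_add' ht0.le (by norm_num)]
    norm_num
  rw [e2] at lower
  have h5 : 0 < A * t ^ (-(3 / 2) : ℝ) := by positivity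
  have h6 : A * t ^ (-(3 / 2) : ℝ) * (Q * t) ≤ A * t ^ (-(3 / 2) : ℝ) * K := by linarith
  have := le_of_mul_le_mul_left h6 h5
  linarith

end MaxPrinciple

section Existence

open Set Filter Topology

/-- A quasiconvex function that is bounded below admits a minimizing sequence which is Cauchy with
respect to any bounded midpoint-preserving map into an inner product space. -/
lemma exists_cauchySeq_minimizing {ι H : Type*} [Nonempty ι] [NormedAddCommGroup H]
    [InnerProductSpace ℝ H] (e : ι → H) (mid : ι → ι → ι) (F : ι → ℝ) {R : ℝ}
    (hR : ∀ a, ‖e a‖ ≤ R) (he : ∀ a b, e (mid a b) = (1 / 2 : ℝ) • (e a + e b))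
    (hF : ∀ a b, F (mid a b) ≤ max (F a) (F b)) (hF0 : ∀ a, 0 ≤ F a) :
    ∃ a : ℕ → ι, CauchySeq (fun n => e (a n)) ∧ ∀ b, ∀ n : ℕ, F (a n) ≤ F b + 1 / (n + 1) := by
  have hbF : BddBelow (range F) := ⟨0, by rintro _ ⟨a, rfl⟩; exact hF0 a⟩
  set C : ℕ → Set ι := fun n => {a | F a ≤ (⨅ b, F b) + 1 / (n + 1)} with hC
  have hCne : ∀ n, (C n).Nonempty := fun n => by
    obtain ⟨a, ha⟩ := exists_lt_of_ciInf_lt (lt_add_of_pos_right (⨅ b, F b)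
      (Nat.one_div_pos_of_nat (α := ℝ) (n := n)))
    exact ⟨a, ha.le⟩
  have hCanti : Antitone C := fun m n hmn a ha => by
    have h1 : F a ≤ (⨅ b, F b) + 1 / ((n : ℝ) + 1) := ha
    have h2 : 1 / ((n : ℝ) + 1) ≤ 1 / ((m : ℝ) + 1) := Nat.one_div_le_one_div hmn
    exact h1.trans (by linarith)
  set q : ℕ → ℝ := fun n => sInf ((fun a => ‖e a‖ ^ 2) '' C n) with hq
  have hqb : ∀ n, BddBelow ((fun a => ‖e a‖ ^ 2) '' C n) := fun n =>
    ⟨0, by rintro _ ⟨a, -, rfl⟩; positivity⟩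
  have hqle : ∀ n, ∀ a ∈ C n, q n ≤ ‖e a‖ ^ 2 := fun n a ha =>
    csInf_le (hqb n) (mem_image_of_mem _ ha)
  have hqmono : Monotone q := fun m n hmn =>
    csInf_le_csInf (hqb m) ((hCne n).image _) (image_mono (hCanti hmn))
  have hqbdd : BddAbove (range q) := ⟨R ^ 2, by
    rintro _ ⟨n, rfl⟩
    obtain ⟨a, ha⟩ := hCne n
    exact (hqle n a ha).trans (pow_le_pow_left₀ (norm_nonneg _) (hR a) 2)⟩
  have hqlim := tendsto_atTop_ciSup hqmono hqbdd
  have hch : ∀ n : ℕ, ∃ a ∈ C n, ‖e a‖ ^ 2 < q n + 1 / (n + 1) := fun n => by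
    obtain ⟨_, ⟨a, ha, rfl⟩, h⟩ := exists_lt_of_csInf_lt ((hCne n).image fun a => ‖e a‖ ^ 2)
      (lt_add_of_pos_right (q n) (Nat.one_div_pos_of_nat (α := ℝ) (n := n)))
    exact ⟨a, ha, h⟩
  choose a haC haq using hch
  refine ⟨a, ?_, fun b n => (haC n).trans (by gcongr; exact ciInf_le hbF b)⟩
  set L := ⨆ n, q n with hL
  have hqL : ∀ n, q n ≤ L := fun n => le_ciSup hqbdd n
  set β : ℕ → ℝ := fun n => 2 * (L - q n) + 4 * (1 / ((n : ℝ) + 1)) with hβ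
  have hβ0 : Tendsto (fun n => √(β n)) atTop (𝓝 0) := by
    have h1 := ((hqlim.const_sub L).const_mul 2).add
      ((tendsto_one_div_add_atTop_nhds_zero_nat (𝕜 := ℝ)).const_mul 4)
    simp only [sub_self, mul_zero, add_zero] at h1
    have h2 := h1.sqrt
    rwa [Real.sqrt_zero] at h2
  have hdist : ∀ n m, n ≤ m → dist (e (a n)) (e (a m)) ≤ √(β n) := fun n m hnm => by
    refine Real.le_sqrt_of_sq_le ?_
    have h1 : mid (a n) (a m) ∈ C n := (hF _ _).trans (max_le (haC n) (hCanti hnm (haC m)))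
    have h2 := hqle n _ h1
    rw [he, norm_smul, mul_pow] at h2
    norm_num at h2
    have h3 := parallelogram_law_with_norm ℝ (e (a n)) (e (a m))
    have h4 := haq n
    have h5 := haq m
    have h6 : 1 / ((m : ℝ) + 1) ≤ 1 / ((n : ℝ) + 1) := Nat.one_div_le_one_div hnm
    have h7 := hqL m
    rw [dist_eq_norm]
    simp only [hβ]
    nlinarith
  exact cauchySeq_of_le_tendsto_0' (fun n => √(β n)) hdist hβ0

variable {Ωp : Set E3} {M V : ℝ} {u v f g φ : E3 → ℝ}

/-- The uniform unit density on a set. -/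
def unitDensity (S : Set E3) : E3 → ℝ := S.indicator fun _ => 1

lemma isDensity_unitDensity {S : Set E3} (hS : MeasurableSet S) (hv : volume S < ⊤) :
    IsDensity 1 (unitDensity S) := by
  refine ⟨⟨measurable_const.indicator hS, ae_of_all _ fun x => ?_⟩,
    (integrable_indicator_iff hS).2 (integrableOn_const hv.ne)⟩
  by_cases hx : x ∈ S <;> simp [unitDensity, hx]

lemma integral_unitDensity {S : Set E3} (hS : MeasurableSet S) :
    ∫ x, unitDensity S x = volume.real S := by
  simp [unitDensity, integral_indicator hS]

/-- Relaxed negative phases: densities between zero and one that vanish on the positive phase and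
have total mass at most `V`. -/
structure Relaxed (Ωp : Set E3) (V : ℝ) (u : E3 → ℝ) : Prop where
  meas : Measurable u
  int : Integrable u
  nonneg : ∀ᵐ x, 0 ≤ u x
  le_one : ∀ᵐ x, u x ≤ 1
  zero : ∀ᵐ x, x ∈ Ωp → u x = 0
  le : ∫ x, u x ≤ V

lemma Relaxed.isDensity (hu : Relaxed Ωp V u) : IsDensity 1 u :=
  ⟨⟨hu.meas, by
    filter_upwards [hu.nonneg, hu.le_one] with x h0 h1
    rwa [abs_of_nonneg h0]⟩, hu.int⟩

/-- Convex combinations of relaxed phases. -/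
lemma Relaxed.lineMap (hu : Relaxed Ωp V u) (hv : Relaxed Ωp V v) {c : ℝ} (h0 : 0 ≤ c)
    (h1 : c ≤ 1) : Relaxed Ωp V (fun x => u x + c * (v x - u x)) where
  meas := hu.meas.add ((hv.meas.sub hu.meas).const_mul c)
  int := hu.int.add ((hv.int.sub hu.int).const_mul c)
  nonneg := by
    filter_upwards [hu.nonneg, hv.nonneg] with x h2 h3
    nlinarith
  le_one := by
    filter_upwards [hu.le_one, hv.le_one] with x h2 h3
    nlinarith
  zero := by
    filter_upwards [hu.zero, hv.zero] with x h2 h3 hx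
    simp [h2 hx, h3 hx]
  le := by
    have hi : Integrable (fun x => v x - u x) := hv.int.sub hu.int
    rw [integral_add hu.int (hi.const_mul c), integral_const_mul, integral_sub hv.int hu.int]
    have := hu.le
    have := hv.le
    nlinarith

/-- The energy of a relaxed configuration. -/
def relaxedEnergy (Ωp : Set E3) (u : E3 → ℝ) : ℝ :=
  coulInner (fun x => unitDensity Ωp x - u x) (fun x => unitDensity Ωp x - u x)

lemma IsDensity.sub (hf : IsDensity M f) (hg : IsDensity V g) :
    IsDensity (M + V) (fun x => f x - g x) := by
  have := hf.add_const_mul hg (-1)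
  simpa [← sub_eq_add_neg] using this

lemma relaxedEnergy_eq (hχ : IsDensity 1 (unitDensity Ωp)) (hu : IsDensity 1 u)
    (hv : IsDensity 1 v) (c : ℝ) :
    relaxedEnergy Ωp (fun x => u x + c * (v x - u x)) = relaxedEnergy Ωp u
      - 2 * c * (∫ x, (v x - u x) * pot (fun x => unitDensity Ωp x - u x) x)
      + c ^ 2 * coulInner (fun x => v x - u x) (fun x => v x - u x) := by
  have h := coulInner_add_const_mul (hχ.sub hu) (hv.sub hu) (-c)
  unfold relaxedEnergy
  have e : (fun x => unitDensity Ωp x - (u x + c * (v x - u x))) =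
      fun x => (unitDensity Ωp x - u x) + -c * (v x - u x) := by ext x; ring
  rw [e, h]
  simp only [coulInner]
  ring

lemma relaxedEnergy_eq_add (hχ : IsDensity 1 (unitDensity Ωp)) (hu : IsDensity 1 u)
    (hv : IsDensity 1 v) :
    relaxedEnergy Ωp v = relaxedEnergy Ωp u
      - 2 * (∫ x, (v x - u x) * pot (fun x => unitDensity Ωp x - u x) x)
      + coulInner (fun x => v x - u x) (fun x => v x - u x) := by
  simpa using relaxedEnergy_eq hχ hu hv 1

lemma relaxedEnergy_nonneg (hχ : IsDensity 1 (unitDensity Ωp)) (hu : IsDensity 1 u) :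
    0 ≤ relaxedEnergy Ωp u := coulInner_self_nonneg (hχ.sub hu)

lemma relaxedEnergy_midpoint_le (hχ : IsDensity 1 (unitDensity Ωp)) (hu : IsDensity 1 u)
    (hv : IsDensity 1 v) :
    relaxedEnergy Ωp (fun x => u x + 1 / 2 * (v x - u x)) ≤
      max (relaxedEnergy Ωp u) (relaxedEnergy Ωp v) := by
  have h1 := relaxedEnergy_eq hχ hu hv (1 / 2)
  have h2 := relaxedEnergy_eq_add hχ hu hv
  have h3 := coulInner_self_nonneg (hv.sub hu)
  have h4 := le_max_left (relaxedEnergy Ωp u) (relaxedEnergy Ωp v)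
  have h5 := le_max_right (relaxedEnergy Ωp u) (relaxedEnergy Ωp v)
  linarith

/-- Bounded sequences of densities that converge almost everywhere to zero converge weakly against
functions vanishing at infinity. -/
lemma tendsto_integral_mul_of_vanishing {w : ℕ → E3 → ℝ} {C : ℝ} (hw : ∀ n, IsDensity M (w n))
    (hC : ∀ n, ∫ x, |w n x| ≤ C) (hlim : ∀ᵐ x, Tendsto (fun n => w n x) atTop (𝓝 0))
    (hφ : IsBdd V φ) (hφ0 : Tendsto φ (cocompact E3) (𝓝 0)) :
    Tendsto (fun n => ∫ x, w n x * φ x) atTop (𝓝 0) := by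
  have hC0 : 0 ≤ C := (integral_nonneg fun _ => abs_nonneg _).trans (hC 0)
  have hM := (hw 0).nonneg
  rw [Metric.tendsto_nhds]
  intro ε hε
  set δ := ε / (2 * (C + 1)) with hδ
  have hδ0 : 0 < δ := by positivity
  obtain ⟨K, hK, hKφ⟩ := mem_cocompact.1 (hφ0 (Metric.ball_mem_nhds 0 hδ0))
  have t1 : Tendsto (fun n => ∫ x in K, w n x * φ x) atTop (𝓝 (∫ x in K, (0 : ℝ))) := by
    refine tendsto_integral_of_dominated_convergence (fun _ => M * V)
      (fun n => ((hw n).meas.mul hφ.meas).aestronglyMeasurable)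
      (integrableOn_const hK.measure_lt_top.ne) (fun n => ?_) ?_
    · filter_upwards [ae_restrict_of_ae (hw n).bdd, ae_restrict_of_ae hφ.bdd] with x h1 h2
      rw [norm_mul]
      exact mul_le_mul h1 h2 (norm_nonneg _) hM
    · filter_upwards [ae_restrict_of_ae hlim] with x hx
      simpa using hx.mul_const (φ x)
  rw [integral_zero] at t1
  filter_upwards [Metric.tendsto_nhds.1 t1 (ε / 2) (by positivity)] with n hn
  have hi := Integrable.mul_isBdd (hw n).int hφ
  have h2 : |∫ x in Kᶜ, w n x * φ x| ≤ ε / 2 := by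
    have : ‖∫ x in Kᶜ, w n x * φ x‖ ≤ ∫ x in Kᶜ, δ * |w n x| := by
      refine norm_integral_le_of_norm_le (((hw n).int.abs.const_mul δ).integrableOn) ?_
      filter_upwards [ae_restrict_mem hK.measurableSet.compl] with x hx
      have := hKφ hx
      rw [mem_preimage, mem_ball_zero_iff] at this
      rw [norm_mul, mul_comm]
      exact mul_le_mul_of_nonneg_right this.le (norm_nonneg _)
    refine this.trans ?_
    rw [integral_const_mul]
    have h3 : ∫ x in Kᶜ, |w n x| ≤ C :=
      (setIntegral_le_integral (hw n).int.abs (ae_of_all _ fun _ => abs_nonneg _)).trans (hC n)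
    calc δ * ∫ x in Kᶜ, |w n x| ≤ δ * (C + 1) := by gcongr; linarith
      _ = ε / 2 := by rw [hδ]; field_simp
  rw [← integral_add_compl hK.measurableSet hi, Real.dist_eq, sub_zero]
  rw [Real.dist_eq, sub_zero] at hn
  exact (abs_add_le _ _).trans_lt (by linarith)

lemma relaxed_of_tendsto {w : ℕ → E3 → ℝ} (hw : ∀ n, Relaxed Ωp V (w n)) (hu : Measurable u)
    (hlim : ∀ᵐ x, Tendsto (fun n => w n x) atTop (𝓝 (u x))) : Relaxed Ωp V u := by
  have h0 : ∀ᵐ x, 0 ≤ u x := by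
    filter_upwards [hlim, ae_all_iff.2 fun n => (hw n).nonneg] with x h1 h2
    exact ge_of_tendsto' h1 h2
  have hV : 0 ≤ V := (integral_nonneg_of_ae (hw 0).nonneg).trans (hw 0).le
  have hfatou : ∫⁻ x, ENNReal.ofReal (u x) ≤ ENNReal.ofReal V := by
    calc ∫⁻ x, ENNReal.ofReal (u x)
        = ∫⁻ x, liminf (fun n => ENNReal.ofReal (w n x)) atTop := by
          refine lintegral_congr_ae ?_
          filter_upwards [hlim] with x hx
          exact (ENNReal.tendsto_ofReal hx).liminf_eq.symm
      _ ≤ liminf (fun n => ∫⁻ x, ENNReal.ofReal (w n x)) atTop :=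
          lintegral_liminf_le fun n => (hw n).meas.ennreal_ofReal
      _ ≤ liminf (fun _ : ℕ => ENNReal.ofReal V) atTop := by
          refine liminf_le_liminf (Eventually.of_forall fun n => ?_)
          rw [← ofReal_integral_eq_lintegral_ofReal (hw n).int (hw n).nonneg]
          exact ENNReal.ofReal_le_ofReal (hw n).le
      _ = ENNReal.ofReal V := liminf_const _
  refine ⟨hu, ⟨hu.aestronglyMeasurable, ?_⟩, h0, ?_, ?_, ?_⟩
  · rw [hasFiniteIntegral_iff_ofReal h0]
    exact hfatou.trans_lt ENNReal.ofReal_lt_top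
  · filter_upwards [hlim, ae_all_iff.2 fun n => (hw n).le_one] with x h1 h2
    exact le_of_tendsto' h1 h2
  · filter_upwards [hlim, ae_all_iff.2 fun n => (hw n).zero] with x h1 h2 hx
    refine tendsto_nhds_unique h1 ?_
    simp only [h2 _ hx]
    exact tendsto_const_nhds
  · rw [integral_eq_lintegral_of_nonneg_ae h0 hu.aestronglyMeasurable]
    exact ENNReal.toReal_le_of_le_ofReal hV hfatou

lemma Relaxed.integrable_sq (hu : Relaxed Ωp V u) : Integrable (fun x => u x ^ 2) := by
  simp only [pow_two]
  exact Integrable.mul_isBdd hu.int hu.isDensity.toIsBdd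

lemma Relaxed.memLp (hu : Relaxed Ωp V u) : MemLp u 2 volume :=
  (memLp_two_iff_integrable_sq hu.int.1).2 hu.integrable_sq

lemma Relaxed.norm_toLp_le (hu : Relaxed Ωp V u) : ‖hu.memLp.toLp u‖ ≤ √V := by
  refine Real.le_sqrt_of_sq_le ?_
  rw [← real_inner_self_eq_norm_sq, L2.inner_def]
  refine le_trans ?_ hu.le
  have h1 : ∫ x, inner ℝ (hu.memLp.toLp u x) (hu.memLp.toLp u x) = ∫ x, u x ^ 2 := by
    refine integral_congr_ae ?_
    filter_upwards [hu.memLp.coeFn_toLp] with x hx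
    rw [hx, real_inner_self_eq_norm_sq, Real.norm_eq_abs, sq_abs]
  rw [h1]
  refine integral_mono_ae hu.integrable_sq hu.int ?_
  filter_upwards [hu.nonneg, hu.le_one] with x h0 h1
  nlinarith

/-- The relaxed energy is lower semicontinuous along almost everywhere convergent sequences. -/
lemma relaxedEnergy_le_of_tendsto (hχ : IsDensity 1 (unitDensity Ωp)) {w : ℕ → E3 → ℝ}
    (hw : ∀ n, Relaxed Ωp V (w n)) (hu : Relaxed Ωp V u)
    (hlim : ∀ᵐ x, Tendsto (fun n => w n x) atTop (𝓝 (u x))) {E : ℝ}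
    (hE : ∀ ε > 0, ∀ᶠ n in atTop, relaxedEnergy Ωp (w n) ≤ E + ε) : relaxedEnergy Ωp u ≤ E := by
  have hρ := hχ.sub hu.isDensity
  have key := tendsto_integral_mul_of_vanishing (w := fun n x => w n x - u x) (C := 2 * V)
    (fun n => (hw n).isDensity.sub hu.isDensity) (fun n => ?_) ?_ hρ.isBdd_pot hρ.tendsto_pot
  · refine le_of_forall_pos_le_add fun ε hε => ?_
    obtain ⟨n, h1, h2⟩ := ((hE (ε / 2) (by positivity)).and
      (key.eventually_lt_const (show 0 < ε / 4 by positivity))).exists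
    have h3 := relaxedEnergy_eq_add hχ hu.isDensity (hw n).isDensity
    have h4 := coulInner_self_nonneg ((hw n).isDensity.sub hu.isDensity)
    linarith
  · calc ∫ x, |w n x - u x| ≤ ∫ x, (w n x + u x) := by
          refine integral_mono_ae ((hw n).int.sub hu.int).abs ((hw n).int.add hu.int) ?_
          filter_upwards [(hw n).nonneg, hu.nonneg] with x h0 h1
          exact abs_sub_le_iff.2 ⟨by linarith, by linarith⟩
      _ ≤ 2 * V := by
          rw [integral_add (hw n).int hu.int]
          linarith [(hw n).le, hu.le]
  · filter_upwards [hlim] with x hx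
    simpa using hx.sub_const (u x)

lemma exists_relaxed_minimizer (hχ : IsDensity 1 (unitDensity Ωp)) (hV : 0 ≤ V) :
    ∃ u, Relaxed Ωp V u ∧ ∀ v, Relaxed Ωp V v → relaxedEnergy Ωp u ≤ relaxedEnergy Ωp v := by
  have h0 : Relaxed Ωp V (fun _ => 0) := by
    refine ⟨measurable_const, integrable_zero _ _ _, ?_, ?_, ?_, ?_⟩ <;> simp [hV]
  have : Nonempty {u // Relaxed Ωp V u} := ⟨⟨_, h0⟩⟩
  obtain ⟨a, hac, haF⟩ := exists_cauchySeq_minimizing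
    (fun w : {u // Relaxed Ωp V u} => w.2.memLp.toLp w.1)
    (fun w₁ w₂ => ⟨_, w₁.2.lineMap w₂.2 (c := 1 / 2) (by norm_num) (by norm_num)⟩)
    (fun w => relaxedEnergy Ωp w.1) (fun w => w.2.norm_toLp_le)
    (fun w₁ w₂ => by
      rw [← MemLp.toLp_add, ← MemLp.toLp_const_smul]
      refine MemLp.toLp_congr _ _ (ae_of_all _ fun x => ?_)
      simp only [Pi.smul_apply, Pi.add_apply, smul_eq_mul]
      ring)
    (fun w₁ w₂ => relaxedEnergy_midpoint_le hχ w₁.2.isDensity w₂.2.isDensity)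
    (fun w => relaxedEnergy_nonneg hχ w.2.isDensity)
  obtain ⟨l, hl⟩ := cauchySeq_tendsto_of_complete hac
  obtain ⟨ns, hns, hlim⟩ := (tendstoInMeasure_of_tendsto_Lp hl).exists_seq_tendsto_ae
  have hlim : ∀ᵐ x, Tendsto (fun n => (a (ns n)).1 x) atTop (𝓝 (l x)) := by
    filter_upwards [hlim, ae_all_iff.2 fun n => (a n).2.memLp.coeFn_toLp] with x h1 h2
    simpa only [h2] using h1
  have hu : Relaxed Ωp V l :=
    relaxed_of_tendsto (fun n => (a (ns n)).2) (Lp.stronglyMeasurable l).measurable hlim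
  refine ⟨l, hu, fun v hv => relaxedEnergy_le_of_tendsto hχ (fun n => (a (ns n)).2) hu hlim
    fun ε hε => ?_⟩
  have h1 := (tendsto_one_div_add_atTop_nhds_zero_nat (𝕜 := ℝ)).comp hns.tendsto_atTop
  filter_upwards [h1.eventually_lt_const hε] with n hn
  have h2 := haF ⟨v, hv⟩ (ns n)
  simp only [Function.comp] at hn
  linarith

end Existence

section EulerLagrange

open Set Filter Topology

variable {Ωp : Set E3} {M V : ℝ} {u v f g φ : E3 → ℝ}

lemma pot_neg (f : E3 → ℝ) (x : E3) : pot (fun y => -f y) x = -pot f x := by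
  simp [pot, integral_neg]

/-- The potential of a relaxed configuration. -/
def relaxedPot (Ωp : Set E3) (u : E3 → ℝ) : E3 → ℝ := pot fun x => unitDensity Ωp x - u x

lemma unitDensity_of_mem {S : Set E3} {x : E3} (hx : x ∈ S) : unitDensity S x = 1 := by
  simp [unitDensity, hx]

lemma unitDensity_of_notMem {S : Set E3} {x : E3} (hx : x ∉ S) : unitDensity S x = 0 := by
  simp [unitDensity, hx]

lemma Relaxed.isDensity_sub (hχ : IsDensity 1 (unitDensity Ωp)) (hu : Relaxed Ωp V u) :
    IsDensity 1 (fun x => unitDensity Ωp x - u x) := by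
  refine ⟨⟨hχ.meas.sub hu.meas, ?_⟩, hχ.int.sub hu.int⟩
  filter_upwards [hu.nonneg, hu.le_one, hu.zero] with x h0 h1 h2
  by_cases hx : x ∈ Ωp
  · rw [unitDensity_of_mem hx, h2 hx]; norm_num
  · rw [unitDensity_of_notMem hx, abs_le]
    constructor <;> linarith

lemma mem_iff_of_unitDensity_eq {S T : Set E3} {x : E3} (h : unitDensity S x = unitDensity T x) :
    x ∈ S ↔ x ∈ T := by
  by_cases hS : x ∈ S <;> by_cases hT : x ∈ T <;> simp_all [unitDensity]

/-- The first-order optimality condition for minimizers of the relaxed energy. -/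
lemma Relaxed.variation_nonpos (hχ : IsDensity 1 (unitDensity Ωp)) (hu : Relaxed Ωp V u)
    (hmin : ∀ v, Relaxed Ωp V v → relaxedEnergy Ωp u ≤ relaxedEnergy Ωp v)
    (hv : Relaxed Ωp V v) : ∫ x, (v x - u x) * relaxedPot Ωp u x ≤ 0 := by
  by_contra! hI
  set I := ∫ x, (v x - u x) * relaxedPot Ωp u x with hIdef
  have hD := coulInner_self_nonneg (hv.isDensity.sub hu.isDensity)
  set D := coulInner (fun x => v x - u x) (fun x => v x - u x) with hDdef
  have hc0 : 0 < I / (D + I) := by positivity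
  have hc1 : I / (D + I) ≤ 1 := div_le_one_of_le₀ (by linarith) (by linarith)
  set c := I / (D + I) with hc
  have h1 := hmin _ (hu.lineMap hv hc0.le hc1)
  rw [relaxedEnergy_eq hχ hu.isDensity hv.isDensity c] at h1
  have h2 : 2 * c * I ≤ c ^ 2 * D := by
    simp only [relaxedPot] at hIdef
    rw [hIdef]
    linarith
  have h3 : c * D ≤ I := by
    rw [hc, div_mul_eq_mul_div, div_le_iff₀ (by positivity)]
    nlinarith
  nlinarith

lemma Relaxed.ae_eq_zero_of_pot_neg (hχ : IsDensity 1 (unitDensity Ωp)) (hu : Relaxed Ωp V u)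
    (hmin : ∀ v, Relaxed Ωp V v → relaxedEnergy Ωp u ≤ relaxedEnergy Ωp v) :
    ∀ᵐ x, relaxedPot Ωp u x < 0 → u x = 0 := by
  have hρ := hu.isDensity_sub hχ
  have hS : MeasurableSet {x | 0 ≤ relaxedPot Ωp u x} :=
    measurableSet_le measurable_const hρ.continuous_pot.measurable
  set S := {x | 0 ≤ relaxedPot Ωp u x} with hSdef
  have hv0 : ∀ᵐ x, 0 ≤ S.indicator u x := by
    filter_upwards [hu.nonneg] with x h
    exact indicator_apply_nonneg fun _ => h
  have hvu : ∀ᵐ x, S.indicator u x ≤ u x := by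
    filter_upwards [hu.nonneg] with x h
    exact indicator_apply_le' (fun _ => le_rfl) fun _ => h
  have hv : Relaxed Ωp V (S.indicator u) := by
    refine ⟨hu.meas.indicator hS, hu.int.indicator hS, hv0, ?_, ?_,
      (integral_mono_ae (hu.int.indicator hS) hu.int hvu).trans hu.le⟩
    · filter_upwards [hvu, hu.le_one] with x h1 h2
      exact h1.trans h2
    · filter_upwards [hu.zero] with x h1 hx
      by_cases hxS : x ∈ S <;> simp [hxS, h1 hx]
  have h1 := hu.variation_nonpos hχ hmin hv
  have h2 : ∀ᵐ x, 0 ≤ (S.indicator u x - u x) * relaxedPot Ωp u x := by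
    filter_upwards [hvu] with x hx
    by_cases hxS : x ∈ S
    · simp [hxS]
    · have : relaxedPot Ωp u x < 0 := not_le.1 hxS
      nlinarith
  have h3 := (integral_eq_zero_iff_of_nonneg_ae h2 (Integrable.mul_isBdd
    (hv.int.sub hu.int) hρ.isBdd_pot)).1 (le_antisymm h1 (integral_nonneg_of_ae h2))
  filter_upwards [h3] with x hx hneg
  have hxS : x ∉ S := not_le.2 hneg
  simpa [hxS, hneg.ne] using hx

lemma Relaxed.relaxedPot_nonneg (hχ : IsDensity 1 (unitDensity Ωp)) (hu : Relaxed Ωp V u)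
    (hmin : ∀ v, Relaxed Ωp V v → relaxedEnergy Ωp u ≤ relaxedEnergy Ωp v) (x : E3) :
    0 ≤ relaxedPot Ωp u x := by
  refine (hu.isDensity_sub hχ).pot_nonneg ?_ x
  filter_upwards [hu.ae_eq_zero_of_pot_neg hχ hmin] with x hx hneg
  rw [hx hneg, sub_zero]
  exact indicator_nonneg (fun _ _ => zero_le_one) x

lemma Relaxed.integral_le (hχ : IsDensity 1 (unitDensity Ωp)) (hΩ : MeasurableSet Ωp)
    (hu : Relaxed Ωp V u) (h0 : ∀ x, 0 ≤ relaxedPot Ωp u x) : ∫ x, u x ≤ volume.real Ωp := by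
  have hρ := hu.isDensity_sub hχ
  have h1 : IsDensity 1 (fun x => -(unitDensity Ωp x - u x)) := ⟨hρ.toIsBdd.neg, hρ.int.neg⟩
  have h2 := h1.integral_nonpos_of_pot_le (integrable_zero E3 ℝ volume) fun x => by
    rw [pot_neg]
    exact neg_nonpos.2 (h0 x)
  rw [integral_neg, integral_sub hχ.int hu.int, integral_unitDensity hΩ] at h2
  linarith

lemma Relaxed.ae_eq_one_of_pot_pos (hχ : IsDensity 1 (unitDensity Ωp)) (hΩ : MeasurableSet Ωp)
    (hu : Relaxed Ωp V u) (hV : ∫ x, u x < V)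
    (hmin : ∀ v, Relaxed Ωp V v → relaxedEnergy Ωp u ≤ relaxedEnergy Ωp v) :
    ∀ᵐ x, 0 < relaxedPot Ωp u x → x ∉ Ωp → u x = 1 := by
  have hρ := hu.isDensity_sub hχ
  have hS : MeasurableSet {x | 0 < relaxedPot Ωp u x} :=
    measurableSet_lt measurable_const hρ.continuous_pot.measurable
  have key : ∀ n : ℕ, ∀ᵐ x, x ∈ ({x | 0 < relaxedPot Ωp u x} \ Ωp) ∩ Metric.ball 0 n →
      u x = 1 := fun n => by
    have hBm := (hS.diff hΩ).inter (measurableSet_ball (x := (0 : E3)) (ε := n))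
    have hBfin : volume (({x | 0 < relaxedPot Ωp u x} \ Ωp) ∩ Metric.ball (0 : E3) n) < ⊤ :=
      (measure_mono inter_subset_right).trans_lt measure_ball_lt_top
    have hBsub : ∀ x ∈ ({x | 0 < relaxedPot Ωp u x} \ Ωp) ∩ Metric.ball (0 : E3) n,
      0 < relaxedPot Ωp u x ∧ x ∉ Ωp := fun x hx => hx.1
    set B := ({x | 0 < relaxedPot Ωp u x} \ Ωp) ∩ Metric.ball (0 : E3) n
    have hBd := isDensity_unitDensity hBm hBfin
    set w : E3 → ℝ := fun x => unitDensity B x * (1 - u x) with hw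
    have hwm : Measurable w := hBd.meas.mul (measurable_const.sub hu.meas)
    have hw1 : ∀ x ∈ B, w x = 1 - u x := fun x hx => by simp [hw, unitDensity_of_mem hx]
    have hw2 : ∀ x ∉ B, w x = 0 := fun x hx => by simp [hw, unitDensity_of_notMem hx]
    have hw0 : ∀ᵐ x, 0 ≤ w x := by
      filter_upwards [hu.le_one] with x h1
      by_cases hx : x ∈ B
      · rw [hw1 x hx]; linarith
      · rw [hw2 x hx]
    have hwle : ∀ᵐ x, w x ≤ unitDensity B x := by
      filter_upwards [hu.nonneg] with x h1
      by_cases hx : x ∈ B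
      · rw [hw1 x hx, unitDensity_of_mem hx]; linarith
      · rw [hw2 x hx, unitDensity_of_notMem hx]
    have hwi : Integrable w := by
      refine hBd.int.mono' hwm.aestronglyMeasurable ?_
      filter_upwards [hw0, hwle] with x h1 h2
      rwa [Real.norm_of_nonneg h1]
    have hwB : ∫ x, w x ≤ volume.real B := by
      rw [← integral_unitDensity hBm]
      exact integral_mono_ae hwi hBd.int hwle
    have hB0 : 0 ≤ volume.real B := measureReal_nonneg
    set δ := V - ∫ x, u x with hδ
    have hδ0 : 0 < δ := sub_pos.2 hV
    have hε0 : 0 < δ / (δ + volume.real B) := by positivity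
    have hε1 : δ / (δ + volume.real B) ≤ 1 := div_le_one_of_le₀ (by linarith) (by linarith)
    have hε2 : δ / (δ + volume.real B) * volume.real B ≤ δ := by
      rw [div_mul_eq_mul_div, div_le_iff₀ (by positivity)]
      nlinarith
    set ε := δ / (δ + volume.real B)
    have hv : Relaxed Ωp V (fun x => u x + ε * w x) := by
      refine ⟨hu.meas.add (hwm.const_mul ε), hu.int.add (hwi.const_mul ε), ?_, ?_, ?_, ?_⟩
      · filter_upwards [hu.nonneg, hw0] with x h1 h2
        positivity
      · filter_upwards [hu.le_one, hw0] with x h1 h2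
        by_cases hx : x ∈ B
        · rw [hw1 x hx]; nlinarith
        · rw [hw2 x hx]; linarith
      · filter_upwards [hu.zero] with x h1 hx
        rw [h1 hx, hw2 x fun h => (hBsub x h).2 hx]
        simp
      · rw [integral_add hu.int (hwi.const_mul ε), integral_const_mul]
        nlinarith
    have h1 := hu.variation_nonpos hχ hmin hv
    simp only [add_sub_cancel_left] at h1
    have h2 : ∀ᵐ x, 0 ≤ ε * w x * relaxedPot Ωp u x := by
      filter_upwards [hw0] with x hx0
      by_cases hx : x ∈ B
      · have := (hBsub x hx).1
        positivity
      · simp [hw2 x hx]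
    have h3 := (integral_eq_zero_iff_of_nonneg_ae h2 (Integrable.mul_isBdd
      (hwi.const_mul ε) hρ.isBdd_pot)).1 (le_antisymm h1 (integral_nonneg_of_ae h2))
    filter_upwards [h3] with x hx hxB
    have h4 : ε * w x * relaxedPot Ωp u x = 0 := hx
    have h5 : w x = 0 := by simpa [hε0.ne', (hBsub x hxB).1.ne'] using h4
    rw [hw1 x hxB] at h5
    linarith
  filter_upwards [ae_all_iff.2 key] with x hx h1 h2
  obtain ⟨n, hn⟩ := exists_nat_gt ‖x‖
  exact hx n ⟨⟨h1, h2⟩, by simpa using hn⟩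

/-- A minimizer of the relaxed energy is the unit density of the set where its potential is
positive, outside the positive phase. -/
lemma Relaxed.ae_eq_unitDensity (hχ : IsDensity 1 (unitDensity Ωp)) (hΩ : MeasurableSet Ωp)
    (hu : Relaxed Ωp V u) (hV : ∫ x, u x < V)
    (hmin : ∀ v, Relaxed Ωp V v → relaxedEnergy Ωp u ≤ relaxedEnergy Ωp v) :
    u =ᵐ[volume] unitDensity ({x | 0 < relaxedPot Ωp u x} \ Ωp) := by
  have hρ := hu.isDensity_sub hχ
  have h0 := hu.relaxedPot_nonneg hχ hmin
  have hZ : MeasurableSet ({x | relaxedPot Ωp u x = 0} \ Ωp) :=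
    (hρ.continuous_pot.measurable (measurableSet_singleton 0)).diff hΩ
  have hbb := hρ.ae_eq_zero_of_pot_eq_zero h0 hZ (fun x hx => hx.1) (by
    filter_upwards [hu.nonneg] with x h1 hx
    rw [unitDensity_of_notMem hx.2]
    linarith)
  filter_upwards [hbb, hu.zero, hu.ae_eq_one_of_pot_pos hχ hΩ hV hmin] with x h1 h2 h3
  by_cases hx : x ∈ Ωp
  · rw [h2 hx, unitDensity_of_notMem fun h => h.2 hx]
  · rcases (h0 x).eq_or_lt with h | h
    · have := h1 ⟨h.symm, hx⟩
      rw [unitDensity_of_notMem hx] at this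
      rw [unitDensity_of_notMem fun hm => hm.1.ne h]
      linarith
    · have hm : x ∈ {x | 0 < relaxedPot Ωp u x} \ Ωp := ⟨h, hx⟩
      rw [h3 h hx, unitDensity_of_mem hm]

lemma coulInner_unitDensity {S T : Set E3} (hS : MeasurableSet S) (hT : MeasurableSet T) :
    coulInner (unitDensity S) (unitDensity T) = ∫ x in S, ∫ y in T, coul x y := by
  unfold coulInner pot
  rw [← integral_indicator hS]
  refine integral_congr_ae (ae_of_all _ fun x => ?_)
  have h : ∫ y, coul x y * unitDensity T y = ∫ y in T, coul x y := by
    rw [← integral_indicator hT]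
    refine integral_congr_ae (ae_of_all _ fun y => ?_)
    by_cases hy : y ∈ T <;> simp [unitDensity, hy]
  simp only [h]
  by_cases hx : x ∈ S <;> simp [unitDensity, hx]

lemma energy_eq_relaxedEnergy {A : Set E3} (hΩ : MeasurableSet Ωp) (hv : volume Ωp < ⊤)
    (hA : MeasurableSet A) (hAv : volume A < ⊤) :
    energy Ωp A = relaxedEnergy Ωp (unitDensity A) := by
  have h1 := isDensity_unitDensity hΩ hv
  have h2 := isDensity_unitDensity hA hAv
  have h3 := coulInner_add_const_mul h1 h2 (-1)
  have e : (fun x => unitDensity Ωp x + -1 * unitDensity A x) =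
      fun x => unitDensity Ωp x - unitDensity A x := by ext x; ring
  rw [e, coulInner_comm h2 h1] at h3
  rw [relaxedEnergy, h3, coulInner_unitDensity hΩ hΩ, coulInner_unitDensity hΩ hA,
    coulInner_unitDensity hA hA, energy]
  ring

lemma relaxedEnergy_congr (h : u =ᵐ[volume] v) : relaxedEnergy Ωp u = relaxedEnergy Ωp v := by
  have : (fun x => unitDensity Ωp x - u x) =ᵐ[volume] fun x => unitDensity Ωp x - v x :=
    h.mono fun x hx => by simp only [hx]
  exact coulInner_congr this this

end EulerLagrange

/-- **Theorem 2.1** (The unconstrained problem: existence, uniqueness and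
charge neutrality). -/
theorem unconstrained_existence_uniqueness_saturation
    (Ωp : Set E3) (hne : Ωp.Nonempty) (ho : IsOpen Ωp) (hb : Bornology.IsBounded Ωp) :
    ∃ Ωm : Set E3, Adm Ωp Ωm ∧
      (∀ A, Adm Ωp A → energy Ωp Ωm ≤ energy Ωp A) ∧
      (∀ A, Adm Ωp A → (∀ B, Adm Ωp B → energy Ωp A ≤ energy Ωp B) →
        volume (symmDiff A Ωm) = 0) ∧
      volume Ωm = volume Ωp := by
  have hΩ := ho.measurableSet
  have hfin := hb.measure_lt_top (μ := volume)
  have hχ := isDensity_unitDensity hΩ hfin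
  have hpos : 0 < volume.real Ωp := ENNReal.toReal_pos (ho.measure_pos volume hne).ne' hfin.ne
  obtain ⟨u, hu, hmin⟩ := exists_relaxed_minimizer (V := 2 * volume.real Ωp) hχ (by positivity)
  have hφ0 := hu.relaxedPot_nonneg hχ hmin
  have hmass := hu.integral_le hχ hΩ hφ0
  have hum := hu.ae_eq_unitDensity hχ hΩ (by linarith) hmin
  have hρ := hu.isDensity_sub hχ
  have hmeas : MeasurableSet ({x | 0 < relaxedPot Ωp u x} \ Ωp) :=
    (measurableSet_lt measurable_const hρ.continuous_pot.measurable).diff hΩ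
  have hmfin : volume ({x | 0 < relaxedPot Ωp u x} \ Ωp) < ⊤ := by
    have := (integrable_indicator_iff hmeas).1 (hu.int.congr hum)
    rwa [integrableOn_const_iff (by simp), or_iff_right (by simp)] at this
  have hnot : ∀ x, x ∉ Ωp → x ∉ {x | 0 < relaxedPot Ωp u x} \ Ωp → relaxedPot Ωp u x = 0 :=
    fun x hx hxm => le_antisymm (not_lt.1 fun h => hxm ⟨h, hx⟩) (hφ0 x)
  have hdisj : Ωp ∩ ({x | 0 < relaxedPot Ωp u x} \ Ωp) = ∅ := Set.inter_sdiff_self _ _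
  set Ωm := {x | 0 < relaxedPot Ωp u x} \ Ωp
  have hadm : Adm Ωp Ωm := ⟨hmeas, by simp [hdisj], hmfin⟩
  have hEm : energy Ωp Ωm = relaxedEnergy Ωp u := by
    rw [energy_eq_relaxedEnergy hΩ hfin hmeas hmfin, relaxedEnergy_congr hum]
  have hcompare : ∀ A, Adm Ωp A → energy Ωp Ωm +
      coulInner (fun x => unitDensity A x - u x) (fun x => unitDensity A x - u x) ≤
      energy Ωp A := fun A hA => by
    rw [hEm, energy_eq_relaxedEnergy hΩ hfin hA.1 hA.2.2, relaxedEnergy_eq_add hχ hu.isDensity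
      (isDensity_unitDensity hA.1 hA.2.2)]
    have : ∫ x, (unitDensity A x - u x) * relaxedPot Ωp u x ≤ 0 := by
      refine integral_nonpos_of_ae ?_
      filter_upwards [hum, measure_eq_zero_iff_ae_notMem.1 hA.2.1] with x h1 h2
      rw [h1]
      by_cases hx : x ∈ Ωp
      · rw [unitDensity_of_notMem fun h => h2 ⟨hx, h⟩,
          unitDensity_of_notMem fun h : x ∈ Ωm => h.2 hx]
        simp
      · by_cases hxm : x ∈ Ωm
        · refine mul_nonpos_of_nonpos_of_nonneg ?_ (hφ0 x)
          rw [unitDensity_of_mem hxm]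
          by_cases hxA : x ∈ A
          · simp [unitDensity_of_mem hxA]
          · simp [unitDensity_of_notMem hxA]
        · simp [hnot x hx hxm]
    simp only [relaxedPot] at this
    linarith
  refine ⟨Ωm, hadm, fun A hA => ?_, fun A hA hAmin => ?_, ?_⟩
  · have := coulInner_self_nonneg ((isDensity_unitDensity hA.1 hA.2.2).sub hu.isDensity)
    linarith [hcompare A hA]
  · have hd := (isDensity_unitDensity hA.1 hA.2.2).sub hu.isDensity
    have h1 := ae_eq_zero_of_coulInner_self_eq_zero hd (le_antisymm
      (by linarith [hcompare A hA, hAmin Ωm hadm]) (coulInner_self_nonneg hd))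
    rw [measure_symmDiff_eq_zero_iff]
    filter_upwards [h1, hum] with x h2 h3
    have h4 : unitDensity A x = unitDensity Ωm x := by
      rw [← h3]; exact sub_eq_zero.1 h2
    exact propext (mem_iff_of_unitDensity_eq h4)
  · have hUm := hmeas.union hΩ
    have hU : volume (Ωm ∪ Ωp) < ⊤ := (measure_union_le _ _).trans_lt
      (ENNReal.add_lt_top.2 ⟨hmfin, hfin⟩)
    have h1 := hρ.integral_nonpos_of_pot_le
      ((isDensity_unitDensity hUm hU).int.const_mul
        (potBound 1 fun x => unitDensity Ωp x - u x)) fun x => by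
        by_cases hx : x ∈ Ωm ∪ Ωp
        · rw [unitDensity_of_mem hx, mul_one]
          exact (le_abs_self _).trans (hρ.abs_pot_le x)
        · rw [unitDensity_of_notMem hx, mul_zero]
          exact (hnot x (fun h => hx (Or.inr h)) fun h => hx (Or.inl h)).le
    rw [integral_sub hχ.int hu.int, integral_unitDensity hΩ] at h1
    have h2 : ∫ x, u x = volume.real Ωm := by
      rw [integral_congr_ae hum, integral_unitDensity hmeas]
    exact (ENNReal.toReal_eq_toReal_iff' hmfin.ne hfin.ne).1 (by
      simp only [Measure.real] at h1 h2 hmass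
      linarith)
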